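/- arXiv:2508.05833 — 2 statements merged into one kernel-verified Lean document; each statement's English description precedes it below -/
import Mathlib

section
/- For all n ≥ 0, a_5(49n + 31) ≡ 0 (mod 7), where a_5(n) counts partitions of n with odd parts unrestricted and even parts 5-colored. -/
/-- `genCubic d n` : the number of partitions of `n` in which odd parts are
unrestricted (always color `0`) and even parts may independently receive one of
`d` colors.  A colored partition is a multiset of (part, color) pairs. -/
noncomputable def genCubic (d n : ℕ) : ℕ :=
  Nat.card {m : Multiset (ℕ × ℕ) //
    (∀ p ∈ m, 0 < p.1 ∧ p.2 < d ∧ (Odd p.1 → p.2 = 0)) ∧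
    (m.map Prod.fst).sum = n}

namespace GC

open PowerSeries Finset

/-- The coefficient field. -/
abbrev K := ZMod 7

instance factPrimeSeven : Fact (Nat.Prime 7) := ⟨by norm_num⟩

/-- Euler's product. -/
noncomputable def E : K⟦X⟧ := pentagonalSeries K

/-- Euler's product at the square. -/
noncomputable def E2 : K⟦X⟧ := expand 2 two_ne_zero E

/-- Truncation of Euler's product. -/
noncomputable def P (n : ℕ) : K⟦X⟧ := ∏ k ∈ range n, (1 - X ^ (k + 1))

/-- Truncation of Euler's product at the square. -/
noncomputable def P2 (n : ℕ) : K⟦X⟧ := ∏ k ∈ range n, (1 - X ^ (2 * (k + 1)))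

/-- Reduction modulo a power of `X`. -/
noncomputable abbrev pr (N : ℕ) : K⟦X⟧ →+* (K⟦X⟧ ⧸ Ideal.span {(X : K⟦X⟧) ^ N}) :=
  Ideal.Quotient.mk _

theorem pr_eq_iff {N : ℕ} {a b : K⟦X⟧} : pr N a = pr N b ↔ X ^ N ∣ a - b := by
  rw [Ideal.Quotient.eq, Ideal.mem_span_singleton]

theorem pr_eq_iff_coeff {N : ℕ} {a b : K⟦X⟧} :
    pr N a = pr N b ↔ ∀ i < N, coeff i a = coeff i b := by
  rw [pr_eq_iff, X_pow_dvd_iff]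
  simp [sub_eq_zero]

theorem eq_of_pr {a b : K⟦X⟧} (h : ∀ N, pr N a = pr N b) : a = b := by
  ext n
  exact pr_eq_iff_coeff.1 (h (n + 1)) n (Nat.lt_succ_self n)

theorem pr_X_pow {N k : ℕ} (h : N ≤ k) : pr N (X ^ k) = 0 := by
  rw [← map_zero (pr N), pr_eq_iff, sub_zero]
  exact pow_dvd_pow _ h

theorem pr_P_le {N n : ℕ} (h : N ≤ n + 1) (m : ℕ) (hm : n ≤ m) : pr N (P m) = pr N (P n) := by
  induction m, hm using Nat.le_induction with
  | base => rfl
  | succ m hm ih =>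
    rw [P, prod_range_succ, map_mul, map_sub, pr_X_pow (by omega), map_one, sub_zero, mul_one]
    exact ih

theorem pr_P {N n : ℕ} (h : N ≤ n + 1) : pr N (P n) = pr N E := by
  rw [pr_eq_iff_coeff]
  intro i hi
  have h1 := coeff_prod_one_sub_X_pow_eventually_eq K i
  rw [Filter.eventually_atTop] at h1
  obtain ⟨s, hs⟩ := h1
  obtain ⟨m, hm⟩ := s.exists_nat_subset_range
  have h2 := hs (range (max m n)) (hm.trans (range_subset_range.2 (le_max_left _ _)))
  rw [E, ← h2]
  exact (pr_eq_iff_coeff.1 (pr_P_le h (max m n) (le_max_right _ _)) i hi).symm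

theorem expand_P (n : ℕ) : expand 2 two_ne_zero (P n) = P2 n := by
  simp [P, P2, map_prod, pow_mul]

theorem pr_P2 {N n : ℕ} (h : N ≤ n + 1) : pr N (P2 n) = pr N E2 := by
  obtain ⟨c, hc⟩ := pr_eq_iff.1 (pr_P h)
  have := congrArg (expand 2 two_ne_zero) hc
  rw [map_sub, expand_P, map_mul, map_pow, expand_X] at this
  rw [pr_eq_iff, E2, this, ← pow_mul]
  exact Dvd.dvd.mul_right (pow_dvd_pow _ (by omega)) _

theorem E_ne_zero : E ≠ 0 := by
  intro h
  have := pr_P (N := 1) (n := 0) (by omega)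
  rw [pr_eq_iff_coeff] at this
  have := this 0 (by omega)
  rw [h] at this
  simp [P] at this

theorem E2_ne_zero : E2 ≠ 0 := by
  intro h
  have := pr_P2 (N := 1) (n := 0) (by omega)
  rw [pr_eq_iff_coeff] at this
  have := this 0 (by omega)
  rw [h] at this
  simp [P2] at this

theorem pow_seven (f : K⟦X⟧) : f ^ 7 = expand 7 (by norm_num) f := by
  have h := MvPowerSeries.map_frobenius_expand (σ := Unit) (R := K) 7 (by norm_num) (f := f)
  rw [ZMod.frobenius_zmod] at h
  rw [← h]
  ext n
  simp [expand]

/-! Shanks' finite form of Gauss' identity -/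

theorem shanks_aux {R : Type*} [CommRing R] (q : R) (A : ℕ → R) (n : ℕ)
    (hA : ∀ s < n, A (s + 1) * (1 - q ^ (2 * s + 2)) = A s * (1 - q ^ (2 * s + 1))) (m : ℕ) (hm : m ≤ n) :
    ∑ s ∈ range m, (A s * (1 - q ^ (2 * n + 2)) * q ^ (s * (2 * n + 3))) =
      (1 - q ^ (2 * n + 1)) * ∑ s ∈ range m, (A s * q ^ (s * (2 * n + 1)))
        + A m * q ^ (m * (2 * n + 1)) * (1 - q ^ (2 * m)) := by
  induction m with
  | zero => simp
  | succ m ih =>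
    rw [sum_range_succ, sum_range_succ, ih (by omega)]
    have h := hA m (by omega)
    have e : A (m + 1) * q ^ ((m + 1) * (2 * n + 1)) * (1 - q ^ (2 * (m + 1))) =
      A m * (1 - q ^ (2 * m + 1)) * q ^ ((m + 1) * (2 * n + 1)) := by
      rw [← h]; ring
    rw [e]
    ring

theorem shanks {R : Type*} [CommRing R] (q : R) (n : ℕ) :
    (∏ k ∈ range n, (1 - q ^ (2 * k + 1))) * ∑ k ∈ range (2 * n), q ^ (k * (k + 1) / 2) =
      ∑ s ∈ range n, ((∏ k ∈ Ico s n, (1 - q ^ (2 * k + 2))) *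
        (∏ k ∈ range s, (1 - q ^ (2 * k + 1)))) * q ^ (s * (2 * n + 1)) := by
  induction n with
  | zero => simp
  | succ n ih =>
    have h := shanks_aux q (fun s => (∏ k ∈ Ico s n, (1 - q ^ (2 * k + 2))) *
        (∏ k ∈ range s, (1 - q ^ (2 * k + 1)))) n (by
        intro s hs
        rw [prod_range_succ, prod_eq_prod_Ico_succ_bot hs]
        ring) n le_rfl
    rw [sum_range_succ, show 2 * (n + 1) = 2 * n + 1 + 1 by ring, sum_range_succ, sum_range_succ,
      prod_range_succ]
    have h2 : ∑ s ∈ range n, ((∏ k ∈ Ico s (n + 1), (1 - q ^ (2 * k + 2))) *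
        (∏ k ∈ range s, (1 - q ^ (2 * k + 1)))) * q ^ (s * (2 * n + 1 + 1 + 1)) =
        ∑ s ∈ range n, ((∏ k ∈ Ico s n, (1 - q ^ (2 * k + 2))) *
        (∏ k ∈ range s, (1 - q ^ (2 * k + 1)))) * (1 - q ^ (2 * n + 2)) * q ^ (s * (2 * n + 3)) := by
      refine sum_congr rfl fun s hs => ?_
      rw [mem_range] at hs
      rw [prod_Ico_succ_top hs.le]
      ring
    rw [h2, h, ← ih]
    have e1 : 2 * n * (2 * n + 1) / 2 = n * (2 * n + 1) := by
      rw [show 2 * n * (2 * n + 1) = n * (2 * n + 1) * 2 by ring, Nat.mul_div_cancel _ (by norm_num)]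
    have e2 : (2 * n + 1) * (2 * n + 1 + 1) / 2 = (2 * n + 1) * (n + 1) := by
      rw [show (2 * n + 1) * (2 * n + 1 + 1) = (2 * n + 1) * (n + 1) * 2 by ring,
        Nat.mul_div_cancel _ (by norm_num)]
    rw [e1, e2]
    simp
    ring

/-- The theta series of triangular numbers. -/
noncomputable def T : K⟦X⟧ := by
  classical exact .mk fun n => if ∃ k : ℕ, k * (k + 1) / 2 = n then 1 else 0

theorem tri_inj {a b : ℕ} (h : a * (a + 1) / 2 = b * (b + 1) / 2) : a = b := by
  have ha := Nat.div_mul_cancel (Nat.even_mul_succ_self a).two_dvd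
  have hb := Nat.div_mul_cancel (Nat.even_mul_succ_self b).two_dvd
  have : a * (a + 1) = b * (b + 1) := by rw [← ha, ← hb, h]
  nlinarith [lt_trichotomy a b]

theorem le_tri (k : ℕ) : k ≤ k * (k + 1) / 2 := by
  rw [Nat.le_div_iff_mul_le (by norm_num)]
  rcases k with _ | k
  · simp
  · nlinarith

theorem pr_T {N n : ℕ} (h : N ≤ n) : pr N (∑ k ∈ range n, X ^ (k * (k + 1) / 2)) = pr N T := by
  classical
  rw [pr_eq_iff_coeff]
  intro i hi
  rw [map_sum]
  simp only [coeff_X_pow, T, coeff_mk]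
  split_ifs with hk
  · obtain ⟨k, rfl⟩ := hk
    rw [sum_eq_single k]
    · simp
    · intro b _ hb
      rw [if_neg]
      intro h'
      exact hb (tri_inj h').symm
    · intro hk
      have := le_tri k
      simp at hk
      omega
  · refine sum_eq_zero fun k _ => if_neg fun h' => hk ⟨k, h'.symm⟩

theorem prod_odd_even {R : Type*} [CommRing R] (q : R) (n : ℕ) :
    (∏ k ∈ range n, (1 - q ^ (2 * k + 1))) * (∏ k ∈ range n, (1 - q ^ (2 * (k + 1)))) =
      ∏ k ∈ range (2 * n), (1 - q ^ (k + 1)) := by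
  induction n with
  | zero => simp
  | succ n ih =>
    rw [prod_range_succ, prod_range_succ, show 2 * (n + 1) = 2 * n + 1 + 1 by ring,
      prod_range_succ, prod_range_succ, ← ih]
    ring

theorem T_mul_E : T * E = E2 ^ 2 := by
  refine eq_of_pr fun N => ?_
  have h := shanks (X : K⟦X⟧) (N + 1)
  rw [sum_range_succ'] at h
  have h' := congrArg (pr N) h
  rw [map_add] at h'
  have z : pr N (∑ s ∈ range N, ((∏ k ∈ Ico (s + 1) (N + 1), (1 - X ^ (2 * k + 2))) *
        (∏ k ∈ range (s + 1), (1 - X ^ (2 * k + 1)))) * X ^ ((s + 1) * (2 * (N + 1) + 1))) = 0 := by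
    rw [map_sum]
    refine sum_eq_zero fun s _ => ?_
    rw [map_mul, pr_X_pow, mul_zero]
    nlinarith
  rw [z, zero_add] at h'
  have e : (∏ k ∈ Ico 0 (N + 1), (1 - X ^ (2 * k + 2)) : K⟦X⟧) = P2 (N + 1) := by
    rw [P2, range_eq_Ico]
    rfl
  simp only [e, range_zero, prod_empty, mul_one, zero_mul, pow_zero] at h'
  have h2 := congrArg (· * pr N (P2 (N + 1))) h'
  simp only [← map_mul] at h2
  rw [mul_right_comm, P2, prod_odd_even, ← P2, map_mul, map_mul] at h2
  change pr N (P _) * _ = _ at h2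
  rw [pr_P (by omega), pr_T (by omega), pr_P2 (by omega)] at h2
  rw [map_mul, mul_comm, h2, map_pow, pow_two]

end GC

namespace GC

open PowerSeries Finset

/-- The character modulo 12. -/
def chi (y : ℤ) : K :=
  if y % 12 = 1 ∨ y % 12 = 11 then 1 else if y % 12 = 5 ∨ y % 12 = 7 then -1 else 0

theorem chi_neg (y : ℤ) : chi (-y) = chi y := by
  unfold chi
  have : (-y) % 12 = 1 ↔ y % 12 = 11 := by omega
  have : (-y) % 12 = 11 ↔ y % 12 = 1 := by omega
  have : (-y) % 12 = 5 ↔ y % 12 = 7 := by omega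
  have : (-y) % 12 = 7 ↔ y % 12 = 5 := by omega
  simp only [*]
  simp only [or_comm]

theorem chi_flip {y z : ℤ} (h : (z - y) % 12 = 6) (ho : y % 2 = 1) (h3 : y % 3 ≠ 0) :
    chi z = - chi y := by
  unfold chi
  have : y % 12 = 1 ∨ y % 12 = 5 ∨ y % 12 = 7 ∨ y % 12 = 11 := by omega
  rcases this with h1 | h1 | h1 | h1
  · have : z % 12 = 7 := by omega
    simp [*]
  · have : z % 12 = 11 := by omega
    simp [*]
  · have : z % 12 = 1 := by omega
    simp [*]
  · have : z % 12 = 5 := by omega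
    simp [*]

/-- Roots of `x ^ 2 = d`. -/
noncomputable def Sq (d : ℤ) : Finset ℤ := {x ∈ Icc (-d) d | x ^ 2 = d}

theorem mem_Sq {d x : ℤ} : x ∈ Sq d ↔ x ^ 2 = d := by
  simp only [Sq, mem_filter, mem_Icc, and_iff_right_iff_imp]
  rintro rfl
  constructor <;> nlinarith [sq_nonneg (x + 1), sq_nonneg (x - 1), Int.le_self_sq x, Int.le_self_sq (-x)]

theorem Sq_sq {x : ℤ} : Sq (x ^ 2) = {x, -x} := by
  ext y
  rw [mem_Sq]
  simp [sq_eq_sq_iff_eq_or_eq_neg]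

theorem two_mul_coeff_T (a : ℕ) : 2 * coeff a T = ∑ _x ∈ Sq (8 * a + 1), (1 : K) := by
  classical
  rw [T, coeff_mk]
  split_ifs with h
  · obtain ⟨k, rfl⟩ := h
    have ha := Nat.div_mul_cancel (Nat.even_mul_succ_self k).two_dvd
    have : (8 * ((k * (k + 1) / 2 : ℕ) : ℤ) + 1) = (2 * k + 1 : ℤ) ^ 2 := by
      zify at ha
      push_cast
      linear_combination 4 * ha
    rw [this, Sq_sq, sum_pair (by omega)]
    norm_num
  · rw [mul_zero, eq_comm]
    refine sum_eq_zero fun x hx => ?_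
    rw [mem_Sq] at hx
    exfalso
    have hodd : x % 2 = 1 := by
      rcases Int.emod_two_eq_zero_or_one x with h0 | h0
      · obtain ⟨z, rfl⟩ := Int.dvd_of_emod_eq_zero h0
        exfalso
        have : 2 * (2 * z ^ 2) = 8 * (a : ℤ) + 1 := by rw [← hx]; ring
        omega
      · exact h0
    apply h
    have hy : |x| % 2 = 1 := by
      rcases abs_choice x with h0 | h0 <;> rw [h0] <;> omega
    have hy0 := abs_nonneg x
    refine ⟨((|x| - 1) / 2).toNat, ?_⟩
    obtain ⟨k, hk⟩ : ∃ k : ℕ, |x| = 2 * k + 1 := ⟨((|x| - 1) / 2).toNat, by omega⟩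
    rw [hk]
    have e : ((2 * (k : ℤ) + 1 - 1) / 2).toNat = k := by omega
    rw [e]
    rw [← sq_abs, hk] at hx
    have : k * (k + 1) = a * 2 := by
      zify
      linarith
    rw [this, Nat.mul_div_cancel _ (by norm_num)]

theorem two_mul_coeff_E (c : ℕ) : 2 * coeff c E = ∑ y ∈ Sq (24 * c + 1), chi y := by
  by_cases h : ∃ k, pentagonal k = c
  · obtain ⟨k, rfl⟩ := h
    rw [E, coeff_pentagonalSeries_pentagonal]
    have := two_mul_natCast_pentagonal k
    have e : 24 * (pentagonal k : ℤ) + 1 = (6 * k - 1) ^ 2 := by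
      linear_combination 12 * this
    rw [e, Sq_sq, sum_pair (by omega), chi_neg, ← two_mul]
    congr 1
    rcases Int.even_or_odd k with hk | hk
    · rw [Int.negOnePow_even k hk]
      obtain ⟨l, rfl⟩ := hk
      have : (6 * (l + l) - 1) % 12 = 11 := by omega
      simp [chi, this]
    · rw [Int.negOnePow_odd k hk]
      obtain ⟨l, rfl⟩ := hk
      have : (6 * (2 * l + 1) - 1) % 12 = 5 := by omega
      simp [chi, this]
  · rw [E, coeff_pentagonalSeries_eq_zero _ (by simpa using h), mul_zero, eq_comm]
    refine sum_eq_zero fun y hy => ?_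
    rw [mem_Sq] at hy
    exfalso
    apply h
    have h6 : y % 6 = 1 ∨ y % 6 = 5 := by
      have hm : (y ^ 2) % 6 = 1 := by omega
      have : y % 6 = 0 ∨ y % 6 = 1 ∨ y % 6 = 2 ∨ y % 6 = 3 ∨ y % 6 = 4 ∨ y % 6 = 5 := by omega
      rcases this with h | h | h | h | h | h <;> simp [pow_two, Int.mul_emod, h] at hm ⊢
    have : ∃ k : ℤ, (6 * k - 1) ^ 2 = y ^ 2 := by
      rcases h6 with h | h
      · refine ⟨- (y / 6), ?_⟩
        have : y = 6 * (y / 6) + 1 := by omega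
        generalize y / 6 = z at *
        rw [this]; ring
      · refine ⟨y / 6 + 1, ?_⟩
        have : y = 6 * (y / 6) + 5 := by omega
        generalize y / 6 = z at *
        rw [this]; ring
    obtain ⟨k, hk⟩ := this
    refine ⟨k, ?_⟩
    have := two_mul_natCast_pentagonal k
    zify
    rw [hy] at hk
    linarith

theorem two_mul_coeff_E2 (b : ℕ) : 2 * coeff b E2 = ∑ y ∈ Sq (12 * b + 1), chi y := by
  rcases Nat.even_or_odd' b with ⟨c, rfl | rfl⟩
  · rw [E2, coeff_expand_mul, two_mul_coeff_E]
    congr 2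
    push_cast
    ring
  · rw [E2, coeff_expand_of_not_dvd _ _ _ (by omega), mul_zero, eq_comm]
    refine sum_eq_zero fun y hy => ?_
    rw [mem_Sq] at hy
    exfalso
    push_cast at hy
    have hm : (y ^ 2) % 8 = 5 := by omega
    have : y % 8 = 0 ∨ y % 8 = 1 ∨ y % 8 = 2 ∨ y % 8 = 3 ∨ y % 8 = 4 ∨ y % 8 = 5 ∨ y % 8 = 6
      ∨ y % 8 = 7 := by omega
    rcases this with h | h | h | h | h | h | h | h <;> simp [pow_two, Int.mul_emod, h] at hm

/-- Representations by the form `3 x ^ 2 + 2 y ^ 2`. -/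
noncomputable def S (D : ℤ) : Finset (ℤ × ℤ) :=
  {p ∈ Icc (-D) D ×ˢ Icc (-D) D | 3 * p.1 ^ 2 + 2 * p.2 ^ 2 = D}

theorem mem_S {D : ℤ} {p : ℤ × ℤ} : p ∈ S D ↔ 3 * p.1 ^ 2 + 2 * p.2 ^ 2 = D := by
  simp only [S, mem_filter, mem_product, mem_Icc, and_iff_right_iff_imp]
  rintro rfl
  have h1 := Int.le_self_sq p.1
  have h2 := Int.le_self_sq (-p.1)
  have h3 := Int.le_self_sq p.2
  have h4 := Int.le_self_sq (-p.2)
  have h5 := sq_nonneg p.1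
  have h6 := sq_nonneg p.2
  rw [neg_sq] at h2 h4
  refine ⟨⟨?_, ?_⟩, ?_, ?_⟩ <;> linarith

theorem parity {N x y : ℤ} (h : 3 * x ^ 2 + 2 * y ^ 2 = 24 * N + 5) :
    x % 2 = 1 ∧ y % 2 = 1 ∧ y % 3 ≠ 0 := by
  have hx : x % 2 = 1 := by
    rcases Int.emod_two_eq_zero_or_one x with h0 | h0
    · obtain ⟨z, rfl⟩ := Int.dvd_of_emod_eq_zero h0
      exfalso
      have : 2 * (6 * z ^ 2 + y ^ 2) = 24 * N + 5 := by rw [← h]; ring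
      omega
    · exact h0
  refine ⟨hx, ?_, ?_⟩
  · rcases Int.emod_two_eq_zero_or_one y with h0 | h0
    · obtain ⟨z, rfl⟩ := Int.dvd_of_emod_eq_zero h0
      exfalso
      obtain ⟨w, hw⟩ : ∃ w, x = 2 * w + 1 := ⟨x / 2, by omega⟩
      have : 4 * (3 * w ^ 2 + 3 * w + 2 * z ^ 2) + 3 = 24 * N + 5 := by rw [← h, hw]; ring
      omega
    · exact h0
  · intro h0
    obtain ⟨z, rfl⟩ := Int.dvd_of_emod_eq_zero h0
    have : 3 * (x ^ 2 + 6 * z ^ 2) = 24 * N + 5 := by rw [← h]; ring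
    omega

theorem sq_mod_eight {x : ℤ} (h : x % 2 = 1) : ∃ a : ℕ, x ^ 2 = 8 * a + 1 := by
  have := Int.sq_mod_four_eq_one_of_odd (Int.odd_iff.2 h)
  have h8 : x ^ 2 % 8 = 1 := by
    have : x % 8 = 1 ∨ x % 8 = 3 ∨ x % 8 = 5 ∨ x % 8 = 7 := by omega
    rcases this with h | h | h | h <;> simp [pow_two, Int.mul_emod, h]
  have := sq_nonneg x
  exact ⟨(x ^ 2 / 8).toNat, by omega⟩

theorem four_mul_coeff (N : ℕ) : 4 * coeff N (T * E2) = ∑ p ∈ S (24 * N + 5), chi p.2 := by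
  have h1 : 4 * coeff N (T * E2) =
      ∑ p ∈ antidiagonal N, (2 * coeff p.1 T) * (2 * coeff p.2 E2) := by
    rw [coeff_mul, mul_sum]
    refine sum_congr rfl fun p _ => by ring
  rw [h1]
  simp_rw [two_mul_coeff_T, two_mul_coeff_E2, sum_mul_sum, one_mul, ← sum_product']
  rw [sum_sigma']
  refine sum_bij (fun s _ => s.2) ?_ ?_ ?_ ?_
  · rintro ⟨⟨a, b⟩, x, y⟩ h
    simp only [mem_sigma, HasAntidiagonal.mem_antidiagonal, mem_product, mem_Sq] at h
    rw [mem_S]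
    obtain ⟨rfl, h2, h3⟩ := h
    simp only [h2, h3]
    push_cast
    ring
  · rintro ⟨⟨a, b⟩, x, y⟩ h ⟨⟨a', b'⟩, x', y'⟩ h' heq
    simp only [mem_sigma, HasAntidiagonal.mem_antidiagonal, mem_product, mem_Sq] at h h'
    simp only at heq
    obtain ⟨rfl, rfl⟩ := Prod.mk.inj heq
    have : a = a' := by omega
    have : b = b' := by omega
    subst_vars
    rfl
  · rintro ⟨x, y⟩ h
    rw [mem_S] at h
    simp only at h
    obtain ⟨hx, hy, hy3⟩ := parity h
    obtain ⟨a, ha⟩ := sq_mod_eight hx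
    have hy1 : y ^ 2 = 12 * (N - a) + 1 := by rw [ha] at h; linarith
    have h0 := sq_nonneg y
    refine ⟨⟨(a, N - a), x, y⟩, ?_, rfl⟩
    have : a ≤ N := by omega
    simp only [mem_sigma, HasAntidiagonal.mem_antidiagonal, mem_product, mem_Sq]
    refine ⟨by omega, ha, ?_⟩
    rw [hy1]
    push_cast [this]
    rfl
  · rintro _ _
    rfl

theorem sum_S_seven (N : ℕ) (hN : N % 7 = 3) :
    ∑ p ∈ S (24 * N + 5), chi p.2 =
      - ∑ p ∈ S (24 * N + 5) with (7 ∣ p.1 ∧ 7 ∣ p.2), chi p.2 := by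
  classical
  set D : ℤ := 24 * N + 5 with hD
  have hD7 : D % 7 = 0 := by omega
  set A := {p ∈ S D | (p.1 - 2 * p.2) % 7 = 0} with hA
  set B := {p ∈ S D | (p.1 + 2 * p.2) % 7 = 0} with hB
  have hun : S D = A ∪ B := by
    rw [hA, hB, ← filter_or, eq_comm, filter_eq_self]
    rintro ⟨x, y⟩ h
    rw [mem_S] at h
    have : (7 : ℤ) ∣ (x - 2 * y) * (x + 2 * y) := by
      obtain ⟨d, hd⟩ := Int.dvd_of_emod_eq_zero hD7
      refine ⟨5 * d - 2 * x ^ 2 - 2 * y ^ 2, ?_⟩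
      simp only at h
      linear_combination 5 * h + 5 * hd
    rcases Int.Prime.dvd_mul' (p := 7) (by norm_num) this with h | h
    · left; exact Int.emod_eq_zero_of_dvd h
    · right; exact Int.emod_eq_zero_of_dvd h
  have hint : A ∩ B = {p ∈ S D | (7 ∣ p.1 ∧ 7 ∣ p.2)} := by
    rw [hA, hB, ← filter_and]
    refine filter_congr fun p _ => ?_
    omega
  have hAB : ∑ p ∈ A, chi p.2 = ∑ p ∈ B, chi p.2 := by
    refine sum_bij' (fun p _ => (p.1, -p.2)) (fun p _ => (p.1, -p.2)) ?_ ?_ ?_ ?_ ?_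
    · intro p hp
      rw [hA, mem_filter, mem_S] at hp
      rw [hB, mem_filter, mem_S]
      simp only
      exact ⟨by rw [neg_sq]; exact hp.1, by omega⟩
    · intro p hp
      rw [hB, mem_filter, mem_S] at hp
      rw [hA, mem_filter, mem_S]
      simp only
      exact ⟨by rw [neg_sq]; exact hp.1, by omega⟩
    · intro p _; simp
    · intro p _; simp
    · intro p _; simp [chi_neg]
  have hAB' : ∑ p ∈ A, chi p.2 = - ∑ p ∈ B, chi p.2 := by
    rw [← sum_neg_distrib]
    refine sum_bij' (fun p _ => ((-5 * p.1 - 4 * p.2) / 7, (6 * p.1 - 5 * p.2) / 7))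
      (fun p _ => ((-5 * p.1 + 4 * p.2) / 7, (-6 * p.1 - 5 * p.2) / 7)) ?_ ?_ ?_ ?_ ?_
    · intro p hp
      rw [hA, mem_filter, mem_S] at hp
      obtain ⟨k, hk⟩ := Int.dvd_of_emod_eq_zero hp.2
      have e0 : p.1 = 2 * p.2 + 7 * k := by linarith
      have e1 : (-5 * p.1 - 4 * p.2) / 7 = - 2 * p.2 - 5 * k := by omega
      have e2 : (6 * p.1 - 5 * p.2) / 7 = p.2 + 6 * k := by omega
      rw [hB, mem_filter, mem_S]
      simp only [e1, e2]
      refine ⟨?_, by omega⟩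
      rw [← hp.1, e0]
      ring
    · intro p hp
      rw [hB, mem_filter, mem_S] at hp
      obtain ⟨k, hk⟩ := Int.dvd_of_emod_eq_zero hp.2
      have e0 : p.1 = - 2 * p.2 + 7 * k := by linarith
      have e1 : (-5 * p.1 + 4 * p.2) / 7 = 2 * p.2 - 5 * k := by omega
      have e2 : (-6 * p.1 - 5 * p.2) / 7 = p.2 - 6 * k := by omega
      rw [hA, mem_filter, mem_S]
      simp only [e1, e2]
      refine ⟨?_, by omega⟩
      rw [← hp.1, e0]
      ring
    · intro p hp
      rw [hA, mem_filter] at hp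
      ext <;> simp only <;> omega
    · intro p hp
      rw [hB, mem_filter] at hp
      ext <;> simp only <;> omega
    · intro p hp
      rw [hA, mem_filter, mem_S] at hp
      obtain ⟨hx, hy, hy3⟩ := parity hp.1
      have hf : chi ((6 * p.1 - 5 * p.2) / 7) = - chi p.2 := chi_flip (by omega) hy hy3
      simp only [hf, neg_neg]
  have hz : ∑ p ∈ B, chi p.2 = 0 := by
    have h2 : (2 : K) * ∑ p ∈ B, chi p.2 = 0 := by
      rw [hAB] at hAB'
      linear_combination hAB'
    exact (mul_eq_zero.1 h2).resolve_left (by decide)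
  have := sum_union_inter (s₁ := A) (s₂ := B) (f := fun p => chi p.2)
  rw [← hun, hint, hAB, hz] at this
  linear_combination this

theorem four_ne : (4 : K) ≠ 0 := by decide

theorem coeff_U_zero (m : ℕ) (hm : m % 7 ≠ 1) : coeff (7 * m + 3) (T * E2) = 0 := by
  have h := four_mul_coeff (7 * m + 3)
  rw [sum_S_seven _ (by omega), sum_eq_zero, neg_zero] at h
  · exact (mul_eq_zero.1 h).resolve_left four_ne
  · intro p hp
    rw [mem_filter, mem_S] at hp
    obtain ⟨h1, ⟨x, hx⟩, ⟨y, hy⟩⟩ := hp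
    exfalso
    rw [hx, hy] at h1
    have : 49 * (3 * x ^ 2 + 2 * y ^ 2) = 24 * ((7 * m + 3 : ℕ) : ℤ) + 5 := by
      rw [← h1]; ring
    omega

theorem coeff_U (k : ℕ) : coeff (49 * k + 10) (T * E2) = coeff k (T * E2) := by
  apply mul_left_cancel₀ four_ne
  rw [four_mul_coeff, four_mul_coeff, sum_S_seven _ (by omega), ← sum_neg_distrib, eq_comm]
  refine sum_bij (fun p _ => (7 * p.1, 7 * p.2)) ?_ ?_ ?_ ?_
  · intro p hp
    rw [mem_S] at hp
    rw [mem_filter, mem_S]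
    refine ⟨?_, by simp, by simp⟩
    push_cast
    linear_combination 49 * hp
  · intro p _ q _ h
    simp only [Prod.mk.injEq] at h
    ext <;> omega
  · intro p hp
    rw [mem_filter, mem_S] at hp
    obtain ⟨h1, ⟨x, hx⟩, ⟨y, hy⟩⟩ := hp
    refine ⟨(x, y), ?_, ?_⟩
    · rw [mem_S]
      rw [hx, hy] at h1
      push_cast at h1
      simp only
      linarith
    · ext <;> simp [hx, hy]
  · intro p hp
    rw [mem_S] at hp
    obtain ⟨hx, hy, hy3⟩ := parity hp
    have hf : chi (7 * p.2) = - chi p.2 := chi_flip (by omega) hy hy3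
    simp only [hf, neg_neg]

end GC

namespace GC

open PowerSeries Finset

/-- Gaussian binomial coefficients. -/
def G {R : Type*} [CommRing R] (q : R) : ℕ → ℕ → R
  | _, 0 => 1
  | 0, _ + 1 => 0
  | n + 1, k + 1 => q ^ (k + 1) * G q n (k + 1) + G q n k

theorem G_zero {R : Type*} [CommRing R] (q : R) (n : ℕ) : G q n 0 = 1 := by
  cases n <;> rfl

theorem G_of_lt {R : Type*} [CommRing R] (q : R) (n : ℕ) : ∀ k, n < k → G q n k = 0 := by
  induction n with
  | zero =>
    intro k hk
    obtain ⟨k, rfl⟩ := Nat.exists_eq_add_of_lt hk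
    simp [G]
  | succ n ih =>
    intro k hk
    obtain ⟨k, rfl⟩ : ∃ l, k = l + 1 := ⟨k - 1, by omega⟩
    rw [G, ih _ (by omega), ih _ (by omega)]
    simp

theorem q_binomial {R A : Type*} [CommRing R] [CommRing A] (φ : R →+* A) (q : R) (y : A) (N : ℕ) :
    ∀ x : A, ∏ i ∈ range N, (y + x * φ q ^ i) =
      ∑ k ∈ range (N + 1), φ (q ^ (k.choose 2) * G q N k) * x ^ k * y ^ (N - k) := by
  induction N with
  | zero => intro x; simp [G_zero]
  | succ N ih =>
    intro x
    rw [prod_range_succ']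
    have h1 : ∏ k ∈ range N, (y + x * φ q ^ (k + 1)) = ∏ k ∈ range N, (y + (x * φ q) * φ q ^ k) := by
      refine prod_congr rfl fun k _ => by ring
    rw [h1, ih, pow_zero, mul_one, mul_add]
    rw [sum_range_succ' _ (N + 1)]
    have h2 : (∑ k ∈ range (N + 1), φ (q ^ (k.choose 2) * G q N k) * (x * φ q) ^ k *
        y ^ (N - k)) * y = ∑ k ∈ range (N + 1), φ (q ^ ((k + 1).choose 2) * (q ^ (k + 1) * G q N (k + 1)))
          * x ^ (k + 1) * y ^ (N - k) + y ^ (N + 1) := by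
      rw [sum_range_succ', sum_range_succ (n := N), G_of_lt q N (N + 1) (by omega), add_mul, sum_mul]
      simp only [mul_zero, map_zero, zero_mul, add_zero]
      congr 1
      · refine sum_congr rfl fun k hk => ?_
        rw [mem_range] at hk
        rw [show N - k = (N - (k + 1)) + 1 by omega]
        simp only [map_mul, map_pow]
        ring
      · simp [G_zero, pow_succ]
    rw [h2, sum_mul]
    have h3 : ∀ k ∈ range (N + 1), φ (q ^ ((k + 1).choose 2) * G q (N + 1) (k + 1)) * x ^ (k + 1) *
        y ^ (N + 1 - (k + 1)) = φ (q ^ ((k + 1).choose 2) * (q ^ (k + 1) * G q N (k + 1)))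
          * x ^ (k + 1) * y ^ (N - k) +
          φ (q ^ (k.choose 2) * G q N k) * (x * φ q) ^ k * y ^ (N - k) * x := by
      intro k _
      rw [G, show N + 1 - (k + 1) = N - k by omega,
        show (k + 1).choose 2 = k + k.choose 2 by rw [Nat.choose_succ_succ' k 1, Nat.choose_one_right]]
      simp only [map_mul, map_pow, map_add]
      ring
    rw [sum_congr rfl h3, sum_add_distrib]
    simp only [G_zero, Nat.choose_zero_succ, pow_zero, mul_one, map_one, one_mul, Nat.sub_zero]
    ring

/-- Finite q-factorials. -/
def F {R : Type*} [CommRing R] (q : R) (n : ℕ) : R := ∏ k ∈ range n, (1 - q ^ (k + 1))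

theorem F_succ {R : Type*} [CommRing R] (q : R) (n : ℕ) : F q (n + 1) = F q n * (1 - q ^ (n + 1)) :=
  prod_range_succ _ _

theorem F_zero {R : Type*} [CommRing R] (q : R) : F q 0 = 1 := rfl

theorem G_self {R : Type*} [CommRing R] (q : R) (n : ℕ) : G q n n = 1 := by
  induction n with
  | zero => rfl
  | succ n ih => rw [G, ih, G_of_lt q n _ (by omega)]; simp

theorem G_mul {R : Type*} [CommRing R] (q : R) (N : ℕ) : ∀ a b, a + b = N →
    G q N a * F q a * F q b = F q N := by
  induction N with
  | zero =>
    intro a b h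
    obtain rfl : a = 0 := by omega
    obtain rfl : b = 0 := by omega
    simp [G_zero, F_zero]
  | succ N ih =>
    intro a b h
    rcases a with _ | a
    · obtain rfl : b = N + 1 := by omega
      simp [G_zero, F_zero]
    rcases b with _ | b
    · obtain rfl : a = N := by omega
      simp [G_self, F_zero]
    have h1 := ih (a + 1) b (by omega)
    have h2 := ih a (b + 1) (by omega)
    rw [G, F_succ q N]
    have e : q ^ (N + 1) = q ^ (a + 1) * q ^ (b + 1) := by rw [← pow_add]; congr 1; omega
    have e1 := F_succ q a
    have e2 := F_succ q b
    rw [e]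
    calc _ = q ^ (a + 1) * (G q N (a + 1) * F q (a + 1) * F q b) * (1 - q ^ (b + 1)) +
          (G q N a * F q a * F q (b + 1)) * (1 - q ^ (a + 1)) := by rw [e1, e2]; ring
      _ = _ := by rw [h1, h2]; ring

theorem prod_low {R : Type*} [CommRing R] (q : R) (n : ℕ) :
    ∏ i ∈ range n, (q ^ n - q ^ i) = (-1) ^ n * q ^ (n.choose 2) * F q n := by
  induction n with
  | zero => simp [F_zero]
  | succ n ih =>
    rw [prod_range_succ']
    have : ∏ k ∈ range n, (q ^ (n + 1) - q ^ (k + 1)) = q ^ n * ∏ i ∈ range n, (q ^ n - q ^ i) := by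
      have hc : q ^ n = ∏ i ∈ range n, q := by simp
      conv_rhs => lhs; rw [hc]
      rw [← prod_mul_distrib]
      refine prod_congr rfl fun k _ => by ring
    rw [this, ih, F_succ, Nat.choose_succ_succ' n 1, Nat.choose_one_right]
    ring

theorem prod_high {R : Type*} [CommRing R] (q : R) (n : ℕ) :
    ∏ i ∈ range n, (q ^ n - q ^ (n + 1 + i)) = q ^ (n * n) * F q n := by
  have : q ^ (n * n) = ∏ i ∈ range n, q ^ n := by simp [pow_mul]
  rw [this, F, ← prod_mul_distrib]
  refine prod_congr rfl fun k _ => by ring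

theorem jacobi_raw {R : Type*} [CommRing R] (q : R) (n : ℕ) :
    q ^ n * ((-1) ^ n * q ^ (n.choose 2) * F q n) * (q ^ (n * n) * F q n) =
      ∑ k ∈ range (2 * n + 1 + 1), q ^ (k.choose 2) * G q (2 * n + 1) k * (-(k * (-1) ^ k)) *
        (q ^ n) ^ (2 * n + 1 - k) := by
  have h := q_binomial (Polynomial.C : R →+* Polynomial R) q (Polynomial.C (q ^ n)) (2 * n + 1)
    Polynomial.X
  have h' := congrArg (fun p => Polynomial.eval (-1) (Polynomial.derivative p)) h
  rw [show 2 * n + 1 = n + 1 + n by ring, prod_range_add, prod_range_succ] at h'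
  have e : (Polynomial.C (q ^ n) + Polynomial.X * Polynomial.C q ^ n : Polynomial R) =
    Polynomial.C (q ^ n) * (1 + Polynomial.X) := by
    rw [map_pow]; ring
  rw [e] at h'
  simp only [Polynomial.derivative_mul, Polynomial.derivative_C, Polynomial.derivative_add,
    Polynomial.derivative_X, Polynomial.derivative_one, Polynomial.eval_add, Polynomial.eval_mul,
    Polynomial.eval_X, Polynomial.eval_C, Polynomial.eval_one, Polynomial.eval_prod,
    Polynomial.derivative_sum, Polynomial.eval_finsetSum, Polynomial.eval_pow,
    Polynomial.eval_zero] at h'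
  have e1 : ∏ i ∈ range n, (q ^ n + -1 * q ^ i) = ∏ i ∈ range n, (q ^ n - q ^ i) :=
    prod_congr rfl fun k _ => by ring
  have e2 : ∏ i ∈ range n, (q ^ n + -1 * q ^ (n + 1 + i)) = ∏ i ∈ range n, (q ^ n - q ^ (n + 1 + i)) :=
    prod_congr rfl fun k _ => by ring
  rw [e1, e2, prod_low, prod_high] at h'
  rw [show 2 * n + 1 = n + 1 + n by ring]
  have e3 : ∀ (k : ℕ), (k : R) * (-1) ^ (k - 1) = -(k * (-1) ^ k) := by
    intro k
    rcases k with _ | k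
    · simp
    · rw [Nat.add_sub_cancel, pow_succ]; ring
  calc _ = _ := by ring
    _ = _ := h'
    _ = _ := by
      refine sum_congr rfl fun k _ => ?_
      rw [← e3]
      simp [Polynomial.derivative_X_pow, ← map_pow]

theorem two_choose (i : ℕ) : 2 * i.choose 2 + i = i * i := by
  induction i with
  | zero => simp
  | succ i ih =>
    rw [Nat.choose_succ_succ' _ 1, Nat.choose_one_right]
    linarith

theorem jacobi_fin (n : ℕ) : P n ^ 2 = ∑ i ∈ range (n + 1), (X : K⟦X⟧) ^ (i * (i + 1) / 2) * (-1) ^ i *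
    (((n : K⟦X⟧) + 1 + (i : K⟦X⟧)) * G (X : K⟦X⟧) (2 * n + 1) (n + 1 + i) -
      ((n : K⟦X⟧) - (i : K⟦X⟧)) * G (X : K⟦X⟧) (2 * n + 1) (n - i)) := by
  have h := jacobi_raw (X : K⟦X⟧) n
  rw [show 2 * n + 1 + 1 = (n + 1) + (n + 1) by ring, sum_range_add, ← sum_range_reflect,
    ← sum_add_distrib] at h
  have hc : ∀ i, (i + 1).choose 2 = i * (i + 1) / 2 := by
    intro i
    rw [Nat.choose_two_right, Nat.add_sub_cancel, mul_comm]
  have hM : (X : K⟦X⟧) ^ (n + n.choose 2 + n * n) * (-1) ^ n ≠ 0 := by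
    apply mul_ne_zero
    · exact pow_ne_zero _ X_ne_zero
    · exact pow_ne_zero _ (by simp)
  apply mul_left_cancel₀ hM
  calc _ = _ := by rw [P, ← F]; ring
    _ = _ := h
    _ = _ := by
      rw [mul_sum]
      refine sum_congr rfl fun i hi => ?_
      rw [mem_range] at hi
      obtain ⟨m, rfl⟩ : ∃ m, n = i + m := ⟨n - i, by omega⟩
      have a1 : i + m + 1 - 1 - i = m := by omega
      have a2 : i + m - i = m := by omega
      have a3 : 2 * (i + m) + 1 - m = 2 * i + m + 1 := by omega
      have a4 : 2 * (i + m) + 1 - (i + m + 1 + i) = m := by omega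
      rw [a1, a2, a3, a4, ← hc]
      have c1 : ∀ a b : ℕ, (a + b).choose 2 = a.choose 2 + b.choose 2 + a * b := by
        intro a b
        induction b with
        | zero => simp
        | succ b ih =>
          rw [← add_assoc, Nat.choose_succ_succ' _ 1, ih, Nat.choose_succ_succ' b 1]
          simp
          ring
      have c2 : i + i.choose 2 = (i + 1).choose 2 := by
        rw [Nat.choose_succ_succ' _ 1, Nat.choose_one_right]
      have c3 := two_choose i
      have x1 : m.choose 2 + (i + m) * (2 * i + m + 1) =
        (i + m + (i + m).choose 2 + (i + m) * (i + m)) + (i + 1).choose 2 := by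
        rw [c1, ← c2]
        nlinarith
      have x2 : (i + m + 1 + i).choose 2 + (i + m) * m =
        (i + m + (i + m).choose 2 + (i + m) * (i + m)) + (i + 1).choose 2 := by
        rw [show i + m + 1 + i = (i + m) + (i + 1) by ring, c1]
        nlinarith
      have s1 : (-1 : K⟦X⟧) ^ (i + m + 1 + i) = - (-1) ^ m := by
        rw [show i + m + 1 + i = 2 * i + (m + 1) by ring, pow_add, pow_mul]; simp [pow_succ]
      have s2 : (-1 : K⟦X⟧) ^ (i + m) * (-1) ^ i = (-1) ^ m := by
        rw [← pow_add, show i + m + i = 2 * i + m by ring, pow_add, pow_mul]; simp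
      calc _ = (X : K⟦X⟧) ^ (m.choose 2 + (i + m) * (2 * i + m + 1)) * (-1) ^ m * (-((m : K⟦X⟧) * G X (2 * (i + m) + 1) m))
            + X ^ ((i + m + 1 + i).choose 2 + (i + m) * m) * (-1) ^ m *
              (((i : K⟦X⟧) + (m : K⟦X⟧) + 1 + (i : K⟦X⟧)) * G X (2 * (i + m) + 1) (i + m + 1 + i)) := by
            rw [s1]
            push_cast
            ring
        _ = _ := by
            rw [x1, x2, ← s2]
            push_cast
            ring

theorem isUnit_E : IsUnit E := by
  rw [PowerSeries.isUnit_iff_constantCoeff, ← coeff_zero_eq_constantCoeff_apply]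
  have := pr_P (N := 1) (n := 0) (by omega)
  rw [pr_eq_iff_coeff] at this
  rw [← this 0 (by omega)]
  simp [P]

theorem pr_G {N a b : ℕ} (ha : N ≤ a) (hb : N ≤ b) : pr N (G X (a + b) a * E) = 1 := by
  have h := congrArg (pr N) (G_mul (X : K⟦X⟧) (a + b) a b rfl)
  change pr N (_ * P a * P b) = pr N (P _) at h
  rw [map_mul, map_mul, pr_P (by omega), pr_P (by omega), pr_P (by omega)] at h
  have hu : IsUnit (pr N E) := isUnit_E.map _
  rw [map_mul]
  apply hu.mul_right_cancel
  rw [h, one_mul]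

theorem pr_E_cube (N n : ℕ) (hn : 2 * N ≤ n) : pr N (E ^ 3) =
    pr N (∑ i ∈ range (n + 1), (X : K⟦X⟧) ^ (i * (i + 1) / 2) * (-1) ^ i * (2 * (i : K⟦X⟧) + 1)) := by
  have h := congrArg (fun t => pr N (t * E)) (jacobi_fin n)
  rw [map_mul, map_pow, pr_P (by omega), ← map_pow, ← map_mul, ← pow_succ] at h
  rw [h, sum_mul, map_sum, map_sum]
  refine sum_congr rfl fun i hi => ?_
  rw [mem_range] at hi
  by_cases hi2 : N ≤ i * (i + 1) / 2
  · simp only [map_mul, pr_X_pow hi2, zero_mul]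
  · have hi3 : i < N := lt_of_le_of_lt (le_tri i) (not_le.1 hi2)
    have g1 := pr_G (N := N) (a := n + 1 + i) (b := n - i) (by omega) (by omega)
    have g2 := pr_G (N := N) (a := n - i) (b := n + 1 + i) (by omega) (by omega)
    rw [show n + 1 + i + (n - i) = 2 * n + 1 by omega] at g1
    rw [show n - i + (n + 1 + i) = 2 * n + 1 by omega] at g2
    have : ∀ a b u v g h : K⟦X⟧, a * b * (u * g - v * h) * E = a * b * (u * (g * E) - v * (h * E)) := by
      intros; ring
    rw [this, map_mul, map_sub, map_mul _ _ (_ * E), map_mul _ _ (_ * E), g1, g2, mul_one, mul_one,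
      ← map_sub, ← map_mul]
    congr 2
    ring

theorem coeff_E_cube (a : ℕ) : coeff a (E ^ 3) = 0 ∨ coeff a (E ^ 3) ^ 2 = 8 * (a : K) + 1 := by
  have h := pr_eq_iff_coeff.1 (pr_E_cube (a + 1) (2 * (a + 1)) le_rfl) a (Nat.lt_succ_self a)
  have e : ∀ i : ℕ, (X : K⟦X⟧) ^ (i * (i + 1) / 2) * (-1) ^ i * (2 * (i : K⟦X⟧) + 1) =
      C ((-1 : K) ^ i * (2 * (i : K) + 1)) * X ^ (i * (i + 1) / 2) := by
    intro i
    have h2 : (C (2 : K) : K⟦X⟧) = 2 := map_ofNat C 2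
    simp [h2]
    ring
  simp only [e, map_sum, coeff_C_mul, coeff_X_pow] at h
  by_cases hk : ∃ k : ℕ, k * (k + 1) / 2 = a
  · right
    obtain ⟨k, rfl⟩ := hk
    rw [sum_eq_single k] at h
    · rw [h]
      simp only [if_true, mul_one, mul_pow, ← pow_mul, mul_comm k 2]
      rw [pow_mul]
      have ha := Nat.div_mul_cancel (Nat.even_mul_succ_self k).two_dvd
      have ha' := congrArg (Nat.cast (R := K)) ha
      push_cast at ha'
      simp only [neg_one_sq, one_pow, one_mul]
      linear_combination -4 * ha'
    · intro b _ hb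
      rw [if_neg, mul_zero]
      intro h'
      exact hb (tri_inj h').symm
    · intro hk
      have := le_tri k
      simp at hk
      omega
  · left
    rw [h]
    refine sum_eq_zero fun k _ => ?_
    rw [if_neg fun h' => hk ⟨k, h'.symm⟩, mul_zero]

theorem coeff_E_six (k : ℕ) : coeff (7 * k + 5) (E ^ 6) = 0 := by
  rw [show E ^ 6 = E ^ 3 * E ^ 3 by ring, coeff_mul]
  refine sum_eq_zero fun p hp => ?_
  rw [HasAntidiagonal.mem_antidiagonal] at hp
  rcases coeff_E_cube p.1 with h1 | h1
  · rw [h1, zero_mul]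
  rcases coeff_E_cube p.2 with h2 | h2
  · rw [h2, mul_zero]
  have hp' := congrArg (Nat.cast (R := K)) hp
  push_cast at hp'
  have h7 : (7 : K) = 0 := by decide
  have h42 : (42 : K) = 0 := by decide
  have h3 : coeff p.1 (E ^ 3) ^ 2 + coeff p.2 (E ^ 3) ^ 2 = 0 := by
    rw [h1, h2]
    linear_combination 8 * hp' + 8 * (k : K) * h7 + h42
  generalize coeff p.1 (E ^ 3) = x at *
  generalize coeff p.2 (E ^ 3) = y at *
  clear h1 h2 hp' hp
  revert x y
  decide

end GC

namespace GC

open PowerSeries Finset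

/-- Geometric series in `X ^ w`. -/
noncomputable def geo (w : ℕ) : K⟦X⟧ := .mk fun n => if w ∣ n then 1 else 0

theorem geo_mul {w : ℕ} (hw : 0 < w) : geo w * (1 - X ^ w) = 1 := by
  ext n
  rw [mul_sub, mul_one, map_sub, coeff_mul_X_pow', geo, coeff_mk, coeff_mk, coeff_one]
  by_cases h : w ≤ n
  · have h1 : w ∣ n - w ↔ w ∣ n := by
      constructor
      · intro h'
        have := Nat.dvd_add h' (dvd_refl w)
        rwa [Nat.sub_add_cancel h] at this
      · intro h'
        exact Nat.dvd_sub h' (dvd_refl w)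
    have h2 : n ≠ 0 := by omega
    simp [h, h1, h2]
  · by_cases h0 : n = 0
    · subst h0
      simp [hw.ne']
    · have : ¬ w ∣ n := fun h' => h (Nat.le_of_dvd (by omega) h')
      simp [h, this, h0]

theorem card_coloured (Q : Finset (ℕ × ℕ)) (hQ : ∀ s ∈ Q, 0 < s.1) (n : ℕ) :
    (Nat.card {m : Multiset (ℕ × ℕ) // (∀ p ∈ m, p ∈ Q) ∧ (m.map Prod.fst).sum = n} : K) =
      coeff n (∏ s ∈ Q, geo s.1) := by
  classical
  rw [coeff_prod]
  have h1 : ∀ l ∈ finsuppAntidiag Q n, ∏ i ∈ Q, coeff (l i) (geo i.1) =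
      if ∀ i ∈ Q, i.1 ∣ l i then (1 : K) else 0 := by
    intro l _
    simp only [geo, coeff_mk]
    rw [prod_ite_zero]
    simp
  rw [sum_congr rfl h1, ← sum_filter, sum_const, nsmul_eq_mul, mul_one]
  congr 1
  rw [← Nat.card_eq_finsetCard]
  have hsum : ∀ m : Multiset (ℕ × ℕ), (∀ p ∈ m, p ∈ Q) →
      ∑ s ∈ Q, s.1 * m.count s = (m.map Prod.fst).sum := by
    intro m hm
    rw [Finset.sum_multiset_map_count]
    rw [← sum_subset (s₁ := m.toFinset)]
    · refine sum_congr rfl fun s _ => by simp [mul_comm]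
    · intro s hs
      exact hm s (Multiset.mem_toFinset.1 hs)
    · intro s _ hs
      rw [Multiset.mem_toFinset] at hs
      rw [Multiset.count_eq_zero_of_notMem hs, mul_zero]
  refine Nat.card_eq_of_bijective (fun m => ⟨Finsupp.onFinset Q
    (fun s => s.1 * m.1.count s) ?_, ?_⟩) ⟨?_, ?_⟩
  · intro s hs
    apply m.2.1
    by_contra h
    exact hs (by rw [Multiset.count_eq_zero_of_notMem h, mul_zero])
  · rw [mem_filter, mem_finsuppAntidiag]
    refine ⟨⟨?_, Finsupp.support_onFinset_subset⟩, ?_⟩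
    · change ∑ s ∈ Q, s.1 * m.1.count s = n
      rw [hsum m.1 m.2.1, m.2.2]
    · intro i _
      simp
  · intro m m' h
    apply Subtype.ext
    ext s
    have h2 := DFunLike.congr_fun (Subtype.mk.inj h) s
    simp only [Finsupp.onFinset_apply] at h2
    by_cases hs : s ∈ Q
    · exact Nat.eq_of_mul_eq_mul_left (hQ s hs) h2
    · rw [Multiset.count_eq_zero_of_notMem fun h => hs (m.2.1 s h),
        Multiset.count_eq_zero_of_notMem fun h => hs (m'.2.1 s h)]
  · rintro ⟨l, hl⟩
    rw [mem_filter, mem_finsuppAntidiag] at hl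
    obtain ⟨⟨hl1, hl2⟩, hl3⟩ := hl
    have hcount : ∀ s, (∑ t ∈ Q, Multiset.replicate (l t / t.1) t).count s =
        if s ∈ Q then l s / s.1 else 0 := by
      intro s
      rw [Multiset.count_sum']
      simp only [Multiset.count_replicate]
      rw [sum_ite_eq' Q s]
    have hmem : ∀ s ∈ (∑ t ∈ Q, Multiset.replicate (l t / t.1) t), s ∈ Q := by
      intro s hs
      by_contra h
      rw [← Multiset.count_pos, hcount, if_neg h] at hs
      omega
    have hval : ∀ s ∈ Q, s.1 * (∑ t ∈ Q, Multiset.replicate (l t / t.1) t).count s = l s := by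
      intro s hs
      rw [hcount, if_pos hs, Nat.mul_div_cancel' (hl3 s hs)]
    refine ⟨⟨∑ t ∈ Q, Multiset.replicate (l t / t.1) t, hmem, ?_⟩, ?_⟩
    · rw [← hsum _ hmem, sum_congr rfl hval, hl1]
    · apply Subtype.ext
      ext s
      simp only [Finsupp.onFinset_apply]
      by_cases hs : s ∈ Q
      · exact hval s hs
      · rw [hcount, if_neg hs, mul_zero, eq_comm]
        by_contra h
        exact hs (hl2 (Finsupp.mem_support_iff.2 h))

/-- Admissible coloured parts of size at most `2 * h`. -/
def Q (h : ℕ) : Finset (ℕ × ℕ) :=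
  (range (2 * h)).image (fun k => (k + 1, 0)) ∪
    (range h ×ˢ Icc 1 4).image (fun k => (2 * (k.1 + 1), k.2))

theorem mem_Q {h : ℕ} {p : ℕ × ℕ} :
    p ∈ Q h ↔ (0 < p.1 ∧ p.2 < 5 ∧ (Odd p.1 → p.2 = 0)) ∧ p.1 ≤ 2 * h := by
  obtain ⟨a, c⟩ := p
  simp only [Q, mem_union, mem_image, mem_range, mem_product, mem_Icc, Prod.mk.injEq, Nat.odd_iff]
  constructor
  · rintro (⟨k, hk, rfl, rfl⟩ | ⟨k, ⟨hk, hc⟩, rfl, rfl⟩)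
    · simp only [implies_true, and_true]; omega
    · omega
  · rintro ⟨⟨h1, h2, h3⟩, h4⟩
    by_cases hc : c = 0
    · left
      exact ⟨a - 1, by omega, by omega, by omega⟩
    · right
      exact ⟨(a / 2 - 1, c), by simp only; omega, by simp only; omega, rfl⟩

theorem prod_Q (h : ℕ) : ∏ s ∈ Q h, (1 - X ^ s.1 : K⟦X⟧) = P (2 * h) * P2 h ^ 4 := by
  rw [Q, prod_union, prod_image, prod_image, prod_product, P, P2, ← prod_pow]
  · congr 1
    refine prod_congr rfl fun k _ => ?_
    simp
  · rintro ⟨a, b⟩ _ ⟨c, d⟩ _ h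
    simp only [Prod.mk.injEq] at h ⊢
    omega
  · intro a _ b _ h
    simp only [Prod.mk.injEq] at h
    omega
  · rw [disjoint_left]
    intro p hp hp'
    simp only [mem_image, mem_range, mem_product, mem_Icc] at hp hp'
    obtain ⟨a, _, rfl⟩ := hp
    obtain ⟨b, hb, h⟩ := hp'
    simp only [Prod.mk.injEq] at h
    omega

/-- The generating function modulo 7. -/
noncomputable def A : K⟦X⟧ := .mk fun n => (genCubic 5 n : K)

theorem coeff_A {n h : ℕ} (hn : n ≤ 2 * h) : coeff n A = coeff n (∏ s ∈ Q h, geo s.1) := by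
  rw [← card_coloured (Q h) (fun s hs => (mem_Q.1 hs).1.1), A, coeff_mk, genCubic]
  congr 1
  refine Nat.card_congr (Equiv.subtypeEquivRight fun m => ?_)
  constructor
  · rintro ⟨h1, h2⟩
    refine ⟨fun p hp => mem_Q.2 ⟨h1 p hp, ?_⟩, h2⟩
    have := Multiset.le_sum_of_mem (Multiset.mem_map_of_mem Prod.fst hp)
    omega
  · rintro ⟨h1, h2⟩
    exact ⟨fun p hp => (mem_Q.1 (h1 p hp)).1, h2⟩

theorem A_mul : A * (E * E2 ^ 4) = 1 := by
  refine eq_of_pr fun N => ?_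
  have h1 : pr N A = pr N (∏ s ∈ Q N, geo s.1) := by
    rw [pr_eq_iff_coeff]
    intro i hi
    exact coeff_A (by omega)
  have h2 : (∏ s ∈ Q N, geo s.1) * (∏ s ∈ Q N, (1 - X ^ s.1 : K⟦X⟧)) = 1 := by
    rw [← prod_mul_distrib]
    exact prod_eq_one fun s hs => geo_mul (mem_Q.1 hs).1.1
  rw [prod_Q] at h2
  rw [map_mul, h1, map_mul, map_pow, ← pr_P (n := 2 * N) (by omega), ← pr_P2 (n := N) (by omega),
    ← map_pow, ← map_mul, ← map_mul, h2]

/-- Extraction of the coefficients in the residue class of `r` modulo 7. -/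
noncomputable def sec (r : ℕ) (f : K⟦X⟧) : K⟦X⟧ := .mk fun n => coeff (7 * n + r) f

theorem sec_mul (r : ℕ) (hr : r < 7) (f g : K⟦X⟧) :
    sec r (f * expand 7 (by norm_num) g) = sec r f * g := by
  ext n
  rw [sec, coeff_mk, coeff_mul, coeff_mul]
  symm
  refine sum_of_injOn (fun p => (7 * p.1 + r, 7 * p.2)) ?_ ?_ ?_ ?_
  · rintro ⟨a, b⟩ _ ⟨c, d⟩ _ h
    simp only [Prod.mk.injEq] at h ⊢
    omega
  · rintro ⟨a, b⟩ h
    simp only [mem_coe, HasAntidiagonal.mem_antidiagonal] at h ⊢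
    omega
  · rintro ⟨a, b⟩ h h'
    rw [HasAntidiagonal.mem_antidiagonal] at h
    simp only at h
    rw [coeff_expand_of_not_dvd, mul_zero]
    rintro ⟨c, rfl⟩
    apply h'
    have hc : c ≤ n := by omega
    have ha : 7 * (n - c) + r = a := by omega
    refine ⟨(n - c, c), ?_, ?_⟩
    · simp only [mem_coe, HasAntidiagonal.mem_antidiagonal]
      omega
    · change (7 * (n - c) + r, 7 * c) = (a, 7 * c)
      rw [ha]
  · rintro ⟨a, b⟩ _
    simp only [sec, coeff_mk, coeff_expand_mul]

theorem sec_U : sec 3 (T * E2) = X * expand 7 (by norm_num) (T * E2) := by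
  ext m
  rw [sec, coeff_mk]
  by_cases hm : m % 7 = 1
  · obtain ⟨k, rfl⟩ : ∃ k, m = 7 * k + 1 := ⟨m / 7, by omega⟩
    rw [show 7 * (7 * k + 1) + 3 = 49 * k + 10 by ring, coeff_U, coeff_succ_X_mul, coeff_expand_mul]
  · rw [coeff_U_zero m hm]
    rcases m with _ | m
    · simp
    · rw [coeff_succ_X_mul, coeff_expand_of_not_dvd]
      omega

theorem A_mul_expand : A * expand 7 (by norm_num) E2 = T * E2 := by
  rw [← pow_seven]
  apply mul_left_cancel₀ E_ne_zero
  calc E * (A * E2 ^ 7) = A * (E * E2 ^ 4) * (E2 ^ 2 * E2) := by ring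
    _ = (T * E) * E2 := by rw [A_mul, one_mul, T_mul_E]
    _ = _ := by ring

theorem sec_A : sec 3 A * E2 = X * expand 7 (by norm_num) (T * E2) := by
  rw [← sec_mul 3 (by norm_num), A_mul_expand, sec_U]

theorem sec_E2_six : sec 4 (X * E2 ^ 6) = 0 := by
  ext n
  rw [sec, coeff_mk, map_zero, show 7 * n + 4 = (7 * n + 3) + 1 by ring, coeff_succ_X_mul, E2,
    ← map_pow]
  by_cases h : 2 ∣ 7 * n + 3
  · obtain ⟨c, hc⟩ := h
    rw [hc, coeff_expand_mul]
    obtain ⟨k, rfl⟩ : ∃ k, c = 7 * k + 5 := ⟨c / 7, by omega⟩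
    exact coeff_E_six k
  · exact coeff_expand_of_not_dvd _ _ _ h

theorem sec_sec_A : sec 4 (sec 3 A) = 0 := by
  have h : sec 3 A * expand 7 (by norm_num) E2 =
      (X * E2 ^ 6) * expand 7 (by norm_num) (T * E2) := by
    rw [← pow_seven]
    calc _ = (sec 3 A * E2) * E2 ^ 6 := by ring
      _ = _ := by rw [sec_A]; ring
  have h' := congrArg (sec 4) h
  rw [sec_mul 4 (by norm_num), sec_mul 4 (by norm_num), sec_E2_six, zero_mul] at h'
  exact (mul_eq_zero.1 h').resolve_right E2_ne_zero

end GC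

theorem stmt_14 : ∀ n : ℕ, 7 ∣ genCubic 5 (49 * n + 31) := by
  intro n
  have h := congrArg (PowerSeries.coeff n) GC.sec_sec_A
  simp only [GC.sec, PowerSeries.coeff_mk, map_zero, GC.A] at h
  rw [show 7 * (7 * n + 4) + 3 = 49 * n + 31 by ring] at h
  exact (ZMod.natCast_eq_zero_iff _ _).1 h
end

section
/- For all n ≥ 0, a_9(121n + 36) ≡ 0 (mod 11), where a_9(n) counts partitions of n with odd parts unrestricted and even parts 9-colored. -/
open PowerSeries


/-- finite Euler product -/
noncomputable def eulerFin (R : Type*) [CommRing R] (N : ℕ) : R⟦X⟧ :=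
  ∏ i ∈ Finset.range N, (1 - X ^ (i + 1) : R⟦X⟧)

lemma eulerFin_coeff_stable (R : Type*) [CommRing R] (N k m : ℕ) (hm : m < N + 1) :
    (eulerFin R (N + k)).coeff m = (eulerFin R N).coeff m := by
  induction k with
  | zero => rfl
  | succ k ih =>
    rw [← ih, eulerFin, ← add_assoc, Finset.prod_range_succ, mul_sub, mul_one, map_sub,
      PowerSeries.coeff_mul_X_pow', if_neg (by omega), sub_zero, eulerFin]

lemma euler_dvd (R : Type*) [CommRing R] (N : ℕ) :
    (X : R⟦X⟧) ^ (N + 1) ∣ pentagonalSeries R - eulerFin R N := by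
  rw [PowerSeries.X_pow_dvd_iff]
  intro m hm
  rw [map_sub, sub_eq_zero]
  obtain ⟨s, hs⟩ := Filter.eventually_atTop.mp (coeff_prod_one_sub_X_pow_eventually_eq R m)
  obtain ⟨L, hL⟩ := s.exists_nat_subset_range
  rw [← hs (Finset.range (N + L)) (hL.trans (by simp)), ← eulerFin_coeff_stable R N L m hm]
  rfl

/-- series are equal if congruent modulo arbitrarily high powers of `X` -/
lemma eq_of_dvd_all {R : Type*} [CommRing R] {f g : R⟦X⟧}
    (h : ∀ n : ℕ, (X : R⟦X⟧) ^ (n + 1) ∣ f - g) : f = g := by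
  ext n
  have := (PowerSeries.X_pow_dvd_iff.mp (h n)) n (by omega)
  rwa [map_sub, sub_eq_zero] at this


instance : Fact (Nat.Prime 11) := ⟨by norm_num⟩

lemma expand_eleven (f : (ZMod 11)⟦X⟧) : expand 11 (by norm_num) f = f ^ 11 := by
  have h := MvPowerSeries.map_frobenius_expand (σ := Unit) (R := ZMod 11) 11 (by norm_num) (f := f)
  rw [ZMod.frobenius_zmod] at h
  simpa using! h

/-- `n ↦ coeff (11 n + r)` -/
noncomputable def dis (r : ℕ) (A : (ZMod 11)⟦X⟧) : (ZMod 11)⟦X⟧ := .mk fun n => A.coeff (11 * n + r)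

lemma dis_mul (r : ℕ) (hr : r < 11) (A B : (ZMod 11)⟦X⟧) :
    dis r (A * expand 11 (by norm_num) B) = dis r A * B := by
  ext n
  rw [dis, coeff_mk, mul_comm A, mul_comm _ B, coeff_mul, coeff_mul]
  symm
  refine Finset.sum_of_injOn (fun p => (11 * p.1, 11 * p.2 + r)) ?_ ?_ ?_ ?_
  · rintro ⟨a, b⟩ - ⟨c, d⟩ - h
    simp only [Prod.mk.injEq] at h ⊢
    omega
  · rintro ⟨a, b⟩ h
    simp only [Finset.mem_coe, Finset.HasAntidiagonal.mem_antidiagonal] at h ⊢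
    omega
  · rintro ⟨a, b⟩ h h2
    simp only [Finset.HasAntidiagonal.mem_antidiagonal] at h
    have : ¬ 11 ∣ a := by
      rintro ⟨c, rfl⟩
      apply h2
      refine ⟨(c, n - c), ?_, ?_⟩
      · simp; omega
      · simp; omega
    rw [coeff_expand_of_not_dvd _ _ _ this, zero_mul]
  · rintro ⟨a, b⟩ h
    simp [coeff_expand_mul, dis]


/-- number of multisets supported on `S` with weight `n` -/
noncomputable def msCount (S : Finset (ℕ × ℕ)) (n : ℕ) : ℕ :=
  Nat.card {m : Multiset (ℕ × ℕ) // (∀ p ∈ m, p ∈ S) ∧ (m.map Prod.fst).sum = n}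

lemma msFinite (S : Finset (ℕ × ℕ)) (hS : ∀ p ∈ S, 0 < p.1) (n : ℕ) :
    Finite {m : Multiset (ℕ × ℕ) // (∀ p ∈ m, p ∈ S) ∧ (m.map Prod.fst).sum = n} := by
  refine Set.Finite.subset (Finset.finite_toSet (Finset.Iic (n • S.val))) ?_
  rintro m ⟨h1, h2⟩
  simp only [Finset.coe_Iic, Set.mem_Iic]
  rw [Multiset.le_iff_count]
  intro a
  by_cases ha : a ∈ m
  · rw [Multiset.count_nsmul, Multiset.count_eq_one_of_mem S.nodup (h1 a ha), mul_one]
    refine (Multiset.count_le_card a m).trans ?_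
    rw [← h2]
    have := Multiset.card_nsmul_le_sum (s := m.map Prod.fst) (a := 1) (by
      intro x hx
      obtain ⟨p, hp, rfl⟩ := Multiset.mem_map.mp hx
      exact hS p (h1 p hp))
    simpa using this
  · simp [Multiset.count_eq_zero_of_notMem ha]

lemma msCount_insert (S : Finset (ℕ × ℕ)) (a : ℕ × ℕ) (ha : a ∉ S) (ha0 : 0 < a.1)
    (hS : ∀ p ∈ S, 0 < p.1) (n : ℕ) :
    msCount (insert a S) n = msCount S n + if a.1 ≤ n then msCount (insert a S) (n - a.1) else 0 := by
  have hS' : ∀ p ∈ insert a S, 0 < p.1 := by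
    intro p hp
    rcases Finset.mem_insert.mp hp with rfl | h
    · exact ha0
    · exact hS p h
  have hf := msFinite (insert a S) hS'
  have hf2 := msFinite S hS
  have key : ∀ T : Finset (ℕ × ℕ), ∀ k, msCount T k =
      {m : Multiset (ℕ × ℕ) | (∀ p ∈ m, p ∈ T) ∧ (m.map Prod.fst).sum = k}.ncard := fun T k => rfl
  simp only [key]
  have hdisj : {m : Multiset (ℕ × ℕ) | (∀ p ∈ m, p ∈ insert a S) ∧ (m.map Prod.fst).sum = n}
      = {m | (∀ p ∈ m, p ∈ S) ∧ (m.map Prod.fst).sum = n} ∪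
        (Multiset.cons a '' {m | a.1 ≤ n ∧ (∀ p ∈ m, p ∈ insert a S) ∧ (m.map Prod.fst).sum = n - a.1}) := by
    ext m
    simp only [Set.mem_ofPred_eq, Set.mem_union, Set.mem_image]
    constructor
    · rintro ⟨h1, h2⟩
      by_cases ham : a ∈ m
      · right
        obtain ⟨t, rfl⟩ := Multiset.exists_cons_of_mem ham
        simp only [Multiset.map_cons, Multiset.sum_cons] at h2
        refine ⟨t, ⟨by omega, fun p hp => h1 p (Multiset.mem_cons_of_mem hp), by omega⟩, rfl⟩
      · left
        refine ⟨fun p hp => ?_, h2⟩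
        rcases Finset.mem_insert.mp (h1 p hp) with rfl | h
        · exact absurd hp ham
        · exact h
    · rintro (⟨h1, h2⟩ | ⟨t, ⟨h0, h1, h2⟩, rfl⟩)
      · exact ⟨fun p hp => Finset.mem_insert_of_mem (h1 p hp), h2⟩
      · refine ⟨fun p hp => ?_, by simp; omega⟩
        rcases Multiset.mem_cons.mp hp with rfl | h
        · exact Finset.mem_insert_self _ _
        · exact h1 p h
  have hd : Disjoint {m : Multiset (ℕ × ℕ) | (∀ p ∈ m, p ∈ S) ∧ (m.map Prod.fst).sum = n}
        (Multiset.cons a '' {m | a.1 ≤ n ∧ (∀ p ∈ m, p ∈ insert a S) ∧ (m.map Prod.fst).sum = n - a.1}) := by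
    rw [Set.disjoint_left]
    rintro m ⟨h1, -⟩ ⟨t, -, rfl⟩
    exact ha (h1 a (Multiset.mem_cons_self a t))
  have hfA : {m : Multiset (ℕ × ℕ) | (∀ p ∈ m, p ∈ S) ∧ (m.map Prod.fst).sum = n}.Finite := hf2 n
  have hfB : {m : Multiset (ℕ × ℕ) | (∀ p ∈ m, p ∈ insert a S) ∧
      (m.map Prod.fst).sum = n - a.1}.Finite := hf (n - a.1)
  have hfC : (Multiset.cons a '' {m | a.1 ≤ n ∧ (∀ p ∈ m, p ∈ insert a S) ∧
      (m.map Prod.fst).sum = n - a.1}).Finite := by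
    refine Set.Finite.image _ (hfB.subset ?_)
    rintro m ⟨-, h⟩
    exact h
  rw [hdisj, Set.ncard_union_eq hd hfA hfC, Set.ncard_image_of_injective _
    (fun s t h => (Multiset.cons_inj_right a).mp h)]
  split_ifs with h
  · simp [h]
  · simp [h]

lemma msCount_gen (R : Type*) [CommRing R] (S : Finset (ℕ × ℕ)) (hS : ∀ p ∈ S, 0 < p.1) :
    (PowerSeries.mk fun n => (msCount S n : R)) * ∏ p ∈ S, (1 - X ^ p.1) = 1 := by
  induction S using Finset.induction_on with
  | empty =>
    ext n
    simp only [Finset.prod_empty, mul_one, coeff_mk, coeff_one]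
    have : msCount ∅ n = if n = 0 then 1 else 0 := by
      have e : msCount ∅ n = {m : Multiset (ℕ × ℕ) | (∀ p ∈ m, p ∈ (∅ : Finset (ℕ × ℕ))) ∧ (m.map Prod.fst).sum = n}.ncard := rfl
      rw [e]
      split_ifs with h
      · rw [Set.ncard_eq_one]
        refine ⟨0, ?_⟩
        ext m
        simp only [Finset.notMem_empty, imp_false, Set.mem_ofPred_eq, Set.mem_singleton_iff]
        constructor
        · rintro ⟨h1, -⟩
          exact Multiset.eq_zero_of_forall_notMem h1
        · rintro rfl; simp [h]
      · have h0 : {m : Multiset (ℕ × ℕ) | (∀ p ∈ m, p ∈ (∅ : Finset (ℕ × ℕ))) ∧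
            (m.map Prod.fst).sum = n} = ∅ := by
          ext m
          simp only [Finset.notMem_empty, imp_false, Set.mem_ofPred_eq, Set.mem_empty_iff_false,
            iff_false]
          rintro ⟨h1, h2⟩
          rw [Multiset.eq_zero_of_forall_notMem h1] at h2
          simp at h2; omega
        rw [h0, Set.ncard_empty]
    rw [this]; split_ifs <;> simp
  | insert a S ha ih =>
    have ha0 := hS a (Finset.mem_insert_self _ _)
    have hS' : ∀ p ∈ S, 0 < p.1 := fun p hp => hS p (Finset.mem_insert_of_mem hp)
    have h : (PowerSeries.mk fun n => (msCount (insert a S) n : R)) * (1 - X ^ a.1)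
        = PowerSeries.mk fun n => (msCount S n : R) := by
      ext n
      rw [mul_sub, mul_one, map_sub, coeff_mul_X_pow', coeff_mk, coeff_mk,
        msCount_insert S a ha ha0 hS' n]
      split_ifs with h
      · simp
      · simp
    rw [Finset.prod_insert ha, ← mul_assoc, h, ih hS']


lemma dvd_iff_mk {R : Type*} [CommRing R] (k : ℕ) (f g : R⟦X⟧) :
    (X : R⟦X⟧) ^ k ∣ f - g ↔ Ideal.Quotient.mk (Ideal.span {(X : R⟦X⟧) ^ k}) f =
      Ideal.Quotient.mk (Ideal.span {(X : R⟦X⟧) ^ k}) g := by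
  rw [Ideal.Quotient.mk_eq_mk_iff_sub_mem, Ideal.mem_span_singleton]

/-- shift embedding -/
def partEmb : (Σ _ : ℕ, ℕ) ↪ ℕ × ℕ :=
  ⟨fun p => (p.1 + 1, p.2), by rintro ⟨a, b⟩ ⟨c, d⟩ h; simp at h; simp [h]⟩

lemma partEmb_apply (a b : ℕ) : partEmb ⟨a, b⟩ = (a + 1, b) := rfl

/-- colored parts of size at most `N` -/
def parts (N : ℕ) : Finset (ℕ × ℕ) :=
  ((Finset.range N).sigma fun i => if Odd (i + 1) then Finset.range 1 else Finset.range 9).map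
    partEmb

lemma mem_parts (N : ℕ) (p : ℕ × ℕ) :
    p ∈ parts N ↔ p.1 ≤ N ∧ (0 < p.1 ∧ p.2 < 9 ∧ (Odd p.1 → p.2 = 0)) := by
  obtain ⟨a, b⟩ := p
  simp only [parts, Finset.mem_map, Finset.mem_sigma, Finset.mem_range, partEmb_apply,
    Prod.mk.injEq, Sigma.exists]
  constructor
  · rintro ⟨i, c, ⟨h1, h2⟩, rfl, rfl⟩
    split_ifs at h2 with h
    · simp at h2; simp [h2]; omega
    · simp at h2; simp [h, h2]; omega
  · rintro ⟨h1, h2, h3, h4⟩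
    refine ⟨a - 1, b, ⟨by omega, ?_⟩, by omega, rfl⟩
    rw [Nat.sub_add_cancel h2]
    split_ifs with h
    · simp [h4 h]
    · simpa using h3

lemma genCubic_eq (N n : ℕ) (h : n ≤ N) : genCubic 9 n = msCount (parts N) n := by
  rw [genCubic, msCount]
  congr 1
  refine congrArg _ (funext fun m => propext (and_congr_left fun hs => ?_))
  refine forall₂_congr fun p hp => ?_
  rw [mem_parts]
  have : p.1 ≤ (m.map Prod.fst).sum :=
    Multiset.single_le_sum (fun _ _ => Nat.zero_le _) _ (Multiset.mem_map_of_mem _ hp)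
  constructor
  · intro h'; exact ⟨by omega, h'⟩
  · exact fun h' => h'.2

lemma prod_parts (R : Type*) [CommRing R] (M : ℕ) :
    ∏ p ∈ parts (2 * M), (1 - X ^ p.1 : R⟦X⟧) =
      eulerFin R (2 * M) * (expand 2 (by norm_num) (eulerFin R M)) ^ 8 := by
  rw [parts, Finset.prod_map, Finset.prod_sigma]
  simp only [partEmb_apply, Finset.prod_const, eulerFin]
  induction M with
  | zero => simp
  | succ M ih =>
    rw [show 2 * (M + 1) = 2 * M + 1 + 1 by ring, Finset.prod_range_succ, Finset.prod_range_succ, ih,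
      Finset.prod_range_succ, Finset.prod_range_succ, Finset.prod_range_succ, if_pos (by simp),
      if_neg (by simp [parity_simps])]
    simp only [map_mul, map_sub, map_one, map_pow, expand_X, Finset.card_range]
    ring

lemma expand_two_dvd (R : Type*) [CommRing R] (M : ℕ) :
    (X : R⟦X⟧) ^ (2 * M + 1) ∣ expand 2 (by norm_num) (pentagonalSeries R) -
      expand 2 (by norm_num) (eulerFin R M) := by
  obtain ⟨c, hc⟩ := euler_dvd R M
  rw [← map_sub, hc, map_mul, map_pow, expand_X, ← pow_mul]
  exact Dvd.dvd.mul_right (pow_dvd_pow _ (by omega)) _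

lemma genCubic_gen (R : Type*) [CommRing R] :
    (PowerSeries.mk fun n => (genCubic 9 n : R)) * pentagonalSeries R *
      (expand 2 (by norm_num) (pentagonalSeries R)) ^ 8 = 1 := by
  apply eq_of_dvd_all
  intro M
  refine (pow_dvd_pow _ (by omega : M + 1 ≤ 2 * M + 1)).trans ?_
  have h1 := (dvd_iff_mk _ _ _).mp (euler_dvd R (2 * M))
  have h2 := (dvd_iff_mk _ _ _).mp (expand_two_dvd R M)
  have h3 : (X : R⟦X⟧) ^ (2 * M + 1) ∣ (PowerSeries.mk fun n => (genCubic 9 n : R)) -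
      PowerSeries.mk fun n => (msCount (parts (2 * M)) n : R) := by
    rw [PowerSeries.X_pow_dvd_iff]
    intro m hm
    rw [map_sub, coeff_mk, coeff_mk, genCubic_eq (2 * M) m (by omega), sub_self]
  have h3 := (dvd_iff_mk _ _ _).mp h3
  have h4 := msCount_gen R (parts (2 * M)) (fun p hp => ((mem_parts _ _).mp hp).2.1)
  rw [prod_parts] at h4
  rw [dvd_iff_mk, map_mul, map_mul, map_pow, h1, h2, h3, ← map_pow, ← map_mul, ← map_mul, mul_assoc,
    h4]


section shanks
variable {A : Type*} [CommRing A] (q : A) (v : ℕ → A)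

/-- ratio `P_n / P_s` in Shanks' identity -/
def shA (n s : ℕ) : A := ∏ i ∈ Finset.Ico s n, ((1 - q ^ (2 * i + 2)) * v i)

lemma shA_self (n : ℕ) : shA q v n n = 1 := by simp [shA]

lemma shA_top (n s : ℕ) (h : s ≤ n) :
    shA q v (n + 1) s = shA q v n s * ((1 - q ^ (2 * n + 2)) * v n) := by
  rw [shA, Finset.prod_Ico_succ_top h, shA]

lemma shA_bot (n s : ℕ) (h : s < n) :
    shA q v n s = ((1 - q ^ (2 * s + 2)) * v s) * shA q v n (s + 1) := by
  rw [shA, Finset.prod_eq_prod_Ico_succ_bot h, shA]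

lemma shanks_partial (hv : ∀ i, v i * (1 - q ^ (2 * i + 1)) = 1) (n m : ℕ) (hm : m ≤ n) :
    (∑ s ∈ Finset.range (m + 1), (shA q v (n + 1) s * q ^ (s * (2 * n + 3))
      - shA q v n s * q ^ (s * (2 * n + 1)))) * (1 - q ^ (2 * n + 1))
      = (1 - q ^ (2 * m + 1)) * shA q v n m * q ^ ((m + 1) * (2 * n + 1)) := by
  induction m with
  | zero =>
    rw [Finset.sum_range_one, shA_top _ _ _ _ hm]
    linear_combination shA q v n 0 * (1 - q ^ (2 * n + 2)) * hv n
  | succ m ih =>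
    rw [Finset.sum_range_succ, add_mul, ih (by omega), shA_top _ _ _ _ hm, shA_bot q v n m (by omega)]
    linear_combination shA q v n (m + 1) * (1 - q ^ (2 * n + 2)) * q ^ ((m + 1) * (2 * n + 3)) * hv n
      + shA q v n (m + 1) * (1 - q ^ (2 * m + 2)) * q ^ ((m + 1) * (2 * n + 1)) * hv m

lemma shanks (hv : ∀ i, v i * (1 - q ^ (2 * i + 1)) = 1) (n : ℕ) :
    ∑ s ∈ Finset.range n, shA q v n s * q ^ (s * (2 * n + 1)) =
      ∑ j ∈ Finset.range (2 * n), q ^ (j * (j + 1) / 2) := by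
  induction n with
  | zero => simp
  | succ n ih =>
    have h := shanks_partial q v hv n n le_rfl
    have h2 : ∑ s ∈ Finset.range (n + 1), (shA q v (n + 1) s * q ^ (s * (2 * n + 3))
      - shA q v n s * q ^ (s * (2 * n + 1))) = q ^ ((n + 1) * (2 * n + 1)) := by
      have h3 := congrArg (v n * ·) h
      simp only [shA_self] at h3
      linear_combination h3 - ((∑ s ∈ Finset.range (n + 1),
        (shA q v (n + 1) s * q ^ (s * (2 * n + 3))
          - shA q v n s * q ^ (s * (2 * n + 1)))) - q ^ ((n + 1) * (2 * n + 1))) * hv n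
    rw [Finset.sum_sub_distrib, Finset.sum_range_succ (fun s => shA q v n s * _), ih, shA_self,
      sub_eq_iff_eq_add] at h2
    rw [show 2 * (n + 1) = 2 * n + 1 + 1 by ring, Finset.sum_range_succ (fun j => q ^ (j * (j + 1) / 2)),
      Finset.sum_range_succ (fun j => q ^ (j * (j + 1) / 2)),
      show 2 * n * (2 * n + 1) / 2 = n * (2 * n + 1) by
        rw [mul_assoc]; exact Nat.mul_div_cancel_left _ (by norm_num),
      show (2 * n + 1) * (2 * n + 1 + 1) / 2 = (n + 1) * (2 * n + 1) by
        rw [show (2 * n + 1) * (2 * n + 1 + 1) = 2 * ((n + 1) * (2 * n + 1)) by ring]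
        exact Nat.mul_div_cancel_left _ (by norm_num)]
    rw [show 2 * n + 1 + 1 + 1 = 2 * n + 3 by ring, h2]
    ring

end shanks

/-- triangular theta series -/
noncomputable def psiS (R : Type*) [CommRing R] : R⟦X⟧ :=
  .mk fun n => ∑ j ∈ Finset.range (n + 1), if n = j * (j + 1) / 2 then 1 else 0

lemma tri_ge (j : ℕ) : j ≤ j * (j + 1) / 2 := by
  rw [Nat.le_div_iff_mul_le (by norm_num)]
  rcases Nat.eq_zero_or_pos j with rfl | h
  · simp
  · exact Nat.mul_le_mul_left _ (by omega)

lemma coeff_psiS (R : Type*) [CommRing R] (n L : ℕ) (h : n + 1 ≤ L) :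
    (psiS R).coeff n = ∑ j ∈ Finset.range L, if n = j * (j + 1) / 2 then 1 else 0 := by
  rw [psiS, coeff_mk]
  refine Finset.sum_subset (by simpa using h) ?_
  intro j _ hj
  have := tri_ge j
  rw [if_neg]
  simp at hj
  omega

lemma psi_identity (K : Type*) [Field K] :
    (expand 2 (by norm_num) (pentagonalSeries K)) ^ 2 = pentagonalSeries K * psiS K := by
  apply eq_of_dvd_all
  intro M
  obtain ⟨n, hn, hnM⟩ : ∃ n, 0 < n ∧ M ≤ n := ⟨M + 1, by omega, by omega⟩
  refine (pow_dvd_pow _ (by omega : M + 1 ≤ 2 * n)).trans ?_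
  have h1 := (dvd_iff_mk _ _ _).mp
    ((pow_dvd_pow X (by omega : 2 * n ≤ 2 * n + 1)).trans (euler_dvd K (2 * n)))
  have h2 := (dvd_iff_mk _ _ _).mp
    ((pow_dvd_pow X (by omega : 2 * n ≤ 2 * n + 1)).trans (expand_two_dvd K n))
  set v : ℕ → K⟦X⟧ := fun i => (1 - X ^ (2 * i + 1))⁻¹ with hv
  have hv1 : ∀ i, v i * (1 - X ^ (2 * i + 1)) = 1 := fun i =>
    PowerSeries.inv_mul_cancel _ (by simp)
  have h3 : eulerFin K (2 * n) = expand 2 (by norm_num) (eulerFin K n) *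
      ∏ i ∈ Finset.range n, (1 - X ^ (2 * i + 1)) := by
    clear * -
    simp only [eulerFin]
    induction n with
    | zero => simp
    | succ M ih =>
      rw [show 2 * (M + 1) = 2 * M + 1 + 1 by ring, Finset.prod_range_succ, Finset.prod_range_succ, ih,
        Finset.prod_range_succ, Finset.prod_range_succ]
      simp only [map_mul, map_sub, map_one, map_pow, expand_X]
      ring
  have h4 : shA X v n 0 * ∏ i ∈ Finset.range n, (1 - X ^ (2 * i + 1)) =
      expand 2 (by norm_num) (eulerFin K n) := by
    rw [shA, ← Finset.range_eq_Ico, ← Finset.prod_mul_distrib, eulerFin, map_prod]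
    refine Finset.prod_congr rfl fun i _ => ?_
    rw [mul_assoc, hv1]
    simp only [map_sub, map_one, map_pow, expand_X]
    ring
  have h5 : (X : K⟦X⟧) ^ (2 * n) ∣ shA X v n 0 - psiS K := by
    have := shanks X v hv1 n
    obtain ⟨k, rfl⟩ : ∃ k, n = k + 1 := ⟨n - 1, by omega⟩
    rw [Finset.sum_range_succ'] at this
    have e : shA X v (k + 1) 0 - psiS K = (∑ j ∈ Finset.range (2 * (k + 1)), X ^ (j * (j + 1) / 2)
       - psiS K) - ∑ s ∈ Finset.range k, shA X v (k + 1) (s + 1) * X ^ ((s + 1) * (2 * (k + 1) + 1)) := by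
      rw [← this, zero_mul, pow_zero]; ring
    rw [e]
    refine dvd_sub ?_ (Finset.dvd_sum fun s _ => Dvd.dvd.mul_left (pow_dvd_pow _ (by nlinarith)) _)
    rw [PowerSeries.X_pow_dvd_iff]
    intro m hm
    rw [map_sub, coeff_psiS K m _ hm, map_sum]
    simp [coeff_X_pow]
  have h5 := (dvd_iff_mk _ _ _).mp h5
  rw [dvd_iff_mk, map_mul, map_pow, h1, h2, ← h5, ← map_pow, ← map_mul, h3]
  congr 1
  linear_combination -(expand 2 (by norm_num) (eulerFin K n)) * h4


/-- sign character on odd `y ≡ 1 (mod 6)` -/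
def sgn6 (y : ℤ) : ZMod 11 := if y % 12 = 1 then 1 else -1

/-- representations `3 x^2 + 2 y^2 = M` -/
noncomputable def repS (M : ℕ) : Finset (ℤ × ℤ) :=
  ((Finset.Icc (-(M : ℤ)) M) ×ˢ (Finset.Icc (-(M : ℤ)) M)).filter fun p =>
    3 * p.1 ^ 2 + 2 * p.2 ^ 2 = M ∧ p.1 % 2 = 1 ∧ p.2 % 6 = 1

lemma mem_repS (M : ℕ) (p : ℤ × ℤ) :
    p ∈ repS M ↔ 3 * p.1 ^ 2 + 2 * p.2 ^ 2 = M ∧ p.1 % 2 = 1 ∧ p.2 % 6 = 1 := by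
  simp only [repS, Finset.mem_filter, Finset.mem_product, Finset.mem_Icc, and_iff_right_iff_imp]
  rintro ⟨h, -, -⟩
  have h1 := Int.le_self_sq p.1
  have h2 := Int.le_self_sq (-p.1)
  have h3 := Int.le_self_sq p.2
  have h4 := Int.le_self_sq (-p.2)
  refine ⟨⟨?_, ?_⟩, ⟨?_, ?_⟩⟩ <;> nlinarith [sq_nonneg p.1, sq_nonneg p.2]

lemma sumA_zero (M : ℕ) :
    ∑ p ∈ (repS M).filter (fun p => (11 : ℤ) ∣ p.1 + 5 * p.2), sgn6 p.2 = 0 := by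
  have key : ∀ p ∈ (repS M).filter (fun p => (11 : ℤ) ∣ p.1 + 5 * p.2), ∃ t, p.1 = 11 * t - 5 * p.2 ∧
      (p.1 + 5 * p.2) / 11 = t ∧ 3 * p.1 ^ 2 + 2 * p.2 ^ 2 = M ∧ p.2 % 6 = 1 ∧ t % 2 = 0 := by
    intro p hp
    rw [Finset.mem_filter, mem_repS] at hp
    obtain ⟨⟨h1, h2, h3⟩, t, ht⟩ := hp
    exact ⟨t, by omega, by omega, h1, h3, by omega⟩
  refine Finset.sum_involution
    (fun p _ => (3 * p.2 - 5 * ((p.1 + 5 * p.2) / 11), 12 * ((p.1 + 5 * p.2) / 11) - 5 * p.2))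
    ?_ ?_ ?_ ?_
  · intro p hp
    obtain ⟨t, h1, h2, h3, h4, h5⟩ := key p hp
    simp only [h2, sgn6]
    rcases (by omega : p.2 % 12 = 1 ∨ p.2 % 12 = 7) with h | h
    · rw [if_pos h, if_neg (by omega)]; simp
    · rw [if_neg (by omega), if_pos (by omega)]; simp
  · intro p hp _ he
    obtain ⟨t, h1, h2, h3, h4, h5⟩ := key p hp
    simp only [h2] at he
    have := congrArg Prod.snd he
    simp only at this
    omega
  · intro p hp
    obtain ⟨t, h1, h2, h3, h4, h5⟩ := key p hp
    rw [Finset.mem_filter, mem_repS]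
    simp only [h2]
    refine ⟨⟨?_, by omega, by omega⟩, by omega⟩
    rw [← h3, h1]; ring
  · intro p hp
    obtain ⟨t, h1, h2, h3, h4, h5⟩ := key p hp
    simp only [h2]
    refine Prod.ext ?_ ?_ <;> simp only <;> omega

lemma sumB_zero (M : ℕ) :
    ∑ p ∈ (repS M).filter (fun p => (11 : ℤ) ∣ p.1 - 5 * p.2), sgn6 p.2 = 0 := by
  rw [← sumA_zero M]
  refine Finset.sum_nbij' (fun p => (-p.1, p.2)) (fun p => (-p.1, p.2)) ?_ ?_ ?_ ?_ ?_
  · intro p hp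
    rw [Finset.mem_filter, mem_repS] at hp ⊢
    obtain ⟨⟨h1, h2, h3⟩, h⟩ := hp
    refine ⟨⟨by simpa using h1, by simp only; omega, h3⟩, by simp only; omega⟩
  · intro p hp
    rw [Finset.mem_filter, mem_repS] at hp ⊢
    obtain ⟨⟨h1, h2, h3⟩, h⟩ := hp
    refine ⟨⟨by simpa using h1, by simp only; omega, h3⟩, by simp only; omega⟩
  · simp
  · simp
  · simp

lemma rep_sum_zero (K : ℕ) (hK : ¬ 11 ∣ K) : ∑ p ∈ repS (11 * K), sgn6 p.2 = 0 := by
  have hun : repS (11 * K) = (repS (11 * K)).filter (fun p => (11 : ℤ) ∣ p.1 + 5 * p.2) ∪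
      (repS (11 * K)).filter (fun p => (11 : ℤ) ∣ p.1 - 5 * p.2) := by
    rw [← Finset.filter_or, eq_comm, Finset.filter_eq_self]
    intro p hp
    rw [mem_repS] at hp
    have hp11 : Prime (11 : ℤ) := by norm_num
    have h1 : (11 : ℤ) ∣ 3 * ((p.1 + 5 * p.2) * (p.1 - 5 * p.2)) := by
      refine ⟨K - 7 * p.2 ^ 2, ?_⟩
      have := hp.1
      push_cast at this
      linear_combination this
    rcases hp11.dvd_or_dvd h1 with h | h
    · norm_num at h
    · exact hp11.dvd_or_dvd h
  have hi := Finset.sum_union_inter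
    (s₁ := (repS (11 * K)).filter (fun p => (11 : ℤ) ∣ p.1 + 5 * p.2))
    (s₂ := (repS (11 * K)).filter (fun p => (11 : ℤ) ∣ p.1 - 5 * p.2)) (f := fun p => sgn6 p.2)
  rw [← hun, sumA_zero, sumB_zero] at hi
  have he : (repS (11 * K)).filter (fun p => (11 : ℤ) ∣ p.1 + 5 * p.2) ∩
      (repS (11 * K)).filter (fun p => (11 : ℤ) ∣ p.1 - 5 * p.2) = ∅ := by
    rw [Finset.eq_empty_iff_forall_notMem]
    intro p hp
    simp only [Finset.mem_inter, Finset.mem_filter, mem_repS] at hp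
    obtain ⟨⟨⟨h1, -, -⟩, h2⟩, -, h3⟩ := hp
    obtain ⟨a, ha⟩ : (11 : ℤ) ∣ p.1 := by omega
    obtain ⟨b, hb⟩ : (11 : ℤ) ∣ p.2 := by omega
    rw [ha, hb] at h1
    apply hK
    zify
    push_cast at h1
    refine ⟨3 * a ^ 2 + 2 * b ^ 2, ?_⟩
    linarith
  rw [he] at hi
  simpa using hi

lemma f2_coeff (a : ℕ) (M : ℕ) (hM : 24 * a + 5 ≤ M) :
    (expand 2 (by norm_num) (pentagonalSeries (ZMod 11))).coeff a =
      ∑ y ∈ (Finset.Icc (-(M : ℤ)) M).filter (fun y : ℤ => y % 6 = 1 ∧ 2 * y ^ 2 = 24 * a + 2), sgn6 y := by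
  by_cases h : ∃ k : ℤ, 2 * pentagonal k = a
  · obtain ⟨k, rfl⟩ := h
    have hk := two_mul_natCast_pentagonal k
    rw [coeff_expand_mul, coeff_pentagonalSeries_pentagonal]
    have : (Finset.Icc (-(M : ℤ)) M).filter
        (fun y : ℤ => y % 6 = 1 ∧ 2 * y ^ 2 = 24 * ((2 * pentagonal k : ℕ) : ℤ) + 2) = {1 - 6 * k} := by
      ext y
      simp only [Finset.mem_filter, Finset.mem_Icc, Finset.mem_singleton]
      push_cast
      rw [hk]
      constructor
      · rintro ⟨-, h1, h2⟩
        have h3 : (y - (1 - 6 * k)) * (y + (1 - 6 * k)) = 0 := by nlinarith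
        rcases mul_eq_zero.mp h3 with h | h <;> omega
      · rintro rfl
        refine ⟨?_, by omega, by ring⟩
        have hM' : (24 * (2 * pentagonal k : ℤ) + 5) ≤ M := by exact_mod_cast hM
        rw [hk] at hM'
        constructor <;> nlinarith [Int.le_self_sq k, Int.le_self_sq (-k)]
    rw [this, Finset.sum_singleton, sgn6]
    rcases Int.even_or_odd k with he | ho
    · rw [if_pos (by obtain ⟨r, rfl⟩ := he; omega)]
      simp [he]
    · rw [if_neg (by obtain ⟨r, rfl⟩ := ho; omega)]
      simp [ho]
  · push Not at h
    rw [Finset.filter_eq_empty_iff.mpr, Finset.sum_empty]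
    · by_cases h2 : 2 ∣ a
      · obtain ⟨b, rfl⟩ := h2
        rw [coeff_expand_mul, coeff_pentagonalSeries_eq_zero]
        rintro ⟨k, rfl⟩
        exact h k rfl
      · exact coeff_expand_of_not_dvd _ _ _ h2
    · rintro y - ⟨h1, h2⟩
      apply h ((1 - y) / 6)
      obtain ⟨k, rfl⟩ : ∃ k, y = 1 - 6 * k := ⟨(1 - y) / 6, by omega⟩
      rw [show (1 - (1 - 6 * k)) / 6 = k by omega]
      zify
      rw [two_mul_natCast_pentagonal]
      nlinarith

lemma tri_two (j : ℕ) : 2 * (j * (j + 1) / 2) = j * (j + 1) :=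
  Nat.mul_div_cancel' (Nat.even_mul_succ_self j).two_dvd

lemma psi_coeff (b : ℕ) (M : ℕ) (hM : 24 * b + 5 ≤ M) :
    2 * (psiS (ZMod 11)).coeff b =
      ∑ x ∈ (Finset.Icc (-(M : ℤ)) M).filter (fun x : ℤ => x % 2 = 1 ∧ 3 * x ^ 2 = 24 * b + 3), 1 := by
  rw [coeff_psiS _ b _ le_rfl]
  by_cases h : ∃ j : ℕ, b = j * (j + 1) / 2
  · obtain ⟨j, hj⟩ := h
    have hj2 := tri_two j
    rw [← hj] at hj2
    have hj2' : (2 * b : ℤ) = j * (j + 1) := by exact_mod_cast hj2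
    have hb : j ≤ b := hj ▸ tri_ge j
    rw [Finset.sum_eq_single j]
    · have : (Finset.Icc (-(M : ℤ)) M).filter (fun x : ℤ => x % 2 = 1 ∧ 3 * x ^ 2 = 24 * (b : ℤ) + 3) =
          {2 * (j : ℤ) + 1, -(2 * (j : ℤ) + 1)} := by
        ext x
        simp only [Finset.mem_filter, Finset.mem_Icc, Finset.mem_singleton, Finset.mem_insert]
        constructor
        · rintro ⟨-, h1, h2⟩
          have h3 : (x - (2 * j + 1)) * (x + (2 * j + 1)) = 0 := by nlinarith
          rcases mul_eq_zero.mp h3 with h | h <;> omega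
        · rintro (rfl | rfl)
          · refine ⟨by omega, by omega, by linear_combination (-12) * hj2'⟩
          · refine ⟨by omega, by omega, by linear_combination (-12) * hj2'⟩
      rw [this, Finset.sum_pair (by omega), if_pos hj]
      norm_num
    · intro i _ hi
      rw [if_neg]
      intro h
      have := tri_two i
      rw [← h, hj2] at this
      rcases lt_or_gt_of_ne hi with h | h <;> nlinarith
    · intro h; simp at h; omega
  · push Not at h
    rw [Finset.filter_eq_empty_iff.mpr, Finset.sum_empty, Finset.sum_eq_zero, mul_zero]
    · intro j _
      rw [if_neg (h j)]
    · rintro x - ⟨h1, h2⟩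
      obtain ⟨j, hj⟩ : ∃ j : ℤ, x = 2 * j + 1 := ⟨x / 2, by omega⟩
      have hb : (2 * b : ℤ) = j * (j + 1) := by subst hj; nlinarith
      rcases le_or_gt 0 j with h0 | h0
      · lift j to ℕ using h0
        apply h j
        have := tri_two j
        have hb' : 2 * b = j * (j + 1) := by exact_mod_cast hb
        omega
      · obtain ⟨i, hi⟩ : ∃ i : ℕ, j = -1 - i := ⟨(-1 - j).toNat, by omega⟩
        apply h i
        have := tri_two i
        have hb' : 2 * b = i * (i + 1) := by
          zify; rw [hb, hi]; ring
        omega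

/-- the series `f_2 ψ` -/
noncomputable def gS : (ZMod 11)⟦X⟧ :=
  expand 2 (by norm_num) (pentagonalSeries (ZMod 11)) * psiS (ZMod 11)

lemma g_coeff (N : ℕ) : 2 * gS.coeff N = ∑ p ∈ repS (24 * N + 5), sgn6 p.2 := by
  rw [gS, coeff_mul, Finset.mul_sum]
  have hmod : ∀ y : ℤ, y % 6 = 1 → ∃ a : ℕ, 2 * y ^ 2 = 24 * a + 2 := by
    intro y hy
    obtain ⟨k, rfl⟩ : ∃ k, y = 1 - 6 * k := ⟨(1 - y) / 6, by omega⟩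
    refine ⟨2 * pentagonal k, ?_⟩
    push_cast
    rw [two_mul_natCast_pentagonal]
    ring
  have hmod2 : ∀ x : ℤ, x % 2 = 1 → ∃ b : ℕ, 3 * x ^ 2 = 24 * b + 3 := by
    intro x hx
    obtain ⟨j, rfl⟩ : ∃ j, x = 2 * j + 1 := ⟨x / 2, by omega⟩
    obtain ⟨r, hr⟩ := Int.even_mul_succ_self j
    have hr0 : 0 ≤ r := by
      have : 0 ≤ j * (j + 1) := by
        rcases le_or_gt 0 j with h | h <;> nlinarith
      omega
    lift r to ℕ using hr0
    exact ⟨r, by linear_combination 12 * hr⟩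
  rw [← Finset.sum_fiberwise_of_maps_to (t := Finset.HasAntidiagonal.antidiagonal N)
    (g := fun p : ℤ × ℤ => (((2 * p.2 ^ 2 - 2) / 24).toNat, ((3 * p.1 ^ 2 - 3) / 24).toNat))]
  · refine Finset.sum_congr rfl ?_
    rintro ⟨a, b⟩ hab
    rw [Finset.HasAntidiagonal.mem_antidiagonal] at hab
    simp only at hab
    rw [f2_coeff a (24 * N + 5) (by omega),
      show ∀ u w : ZMod 11, 2 * (u * w) = (2 * w) * u by intros; ring,
      psi_coeff b (24 * N + 5) (by omega), Finset.sum_mul_sum, ← Finset.sum_product']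
    refine Finset.sum_congr ?_ (fun _ _ => one_mul _)
    ext ⟨x, y⟩
    simp only [Finset.mem_product, Finset.mem_filter, Prod.mk.injEq]
    constructor
    · rintro ⟨⟨hx, hx1, hx2⟩, hy, hy1, hy2⟩
      refine ⟨(mem_repS _ _).mpr ⟨?_, hx1, hy1⟩, by omega, by omega⟩
      simp only
      rw [hx2, hy2]; push_cast [← hab]; ring
    · rintro ⟨h, h1, h2⟩
      have hm := h
      rw [repS, Finset.mem_filter, Finset.mem_product] at hm
      obtain ⟨hb, h3, h4, h5⟩ := hm
      simp only at hb h3 h4 h5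
      obtain ⟨a', ha⟩ := hmod y h5
      obtain ⟨b', hb'⟩ := hmod2 x h4
      exact ⟨⟨hb.1, h4, by omega⟩, hb.2, h5, by omega⟩
  · rintro ⟨x, y⟩ h
    rw [mem_repS] at h
    obtain ⟨h3, h4, h5⟩ := h
    simp only at h3 h4 h5
    obtain ⟨a', ha⟩ := hmod y h5
    obtain ⟨b', hb'⟩ := hmod2 x h4
    rw [Finset.HasAntidiagonal.mem_antidiagonal]
    simp only
    push_cast at h3
    omega

lemma dis_g_zero (n : ℕ) (hn : n % 11 ≠ 2) : (dis 3 gS).coeff n = 0 := by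
  rw [dis, coeff_mk]
  have h := g_coeff (11 * n + 3)
  rw [show 24 * (11 * n + 3) + 5 = 11 * (24 * n + 7) by ring, rep_sum_zero _ (by omega)] at h
  exact (mul_eq_zero.mp h).resolve_left (by decide)


lemma prod_neg_pow {A : Type*} [CommRing A] (q : A) (s : Finset ℕ) :
    ∏ i ∈ s, (-q ^ (i + 1)) = (-1) ^ s.card * q ^ (∑ i ∈ s, (i + 1)) := by
  rw [Finset.prod_neg, Finset.prod_pow_eq_pow_sum]

lemma pent_eval (q : ℂ) (hq : ‖q‖ < 1) :
    HasSum (fun n => (pentagonalSeries ℂ).coeff n * q ^ n) (∏' i : ℕ, (1 - q ^ (i + 1))) := by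
  have hs : Summable (fun s : Finset ℕ => ∏ i ∈ s, (-q ^ (i + 1))) := by
    apply summable_finsetProd_of_summable_norm
    simpa using (summable_nat_add_iff 1).mpr (summable_geometric_of_lt_one (norm_nonneg _) hq)
  have h1 := hs.hasSum
  rw [← tprod_one_add hs] at h1
  simp only [← sub_eq_add_neg] at h1
  have h2 := h1.tsum_fiberwise (fun s : Finset ℕ => ∑ i ∈ s, (i + 1))
  suffices h4 : ∀ n, (pentagonalSeries ℂ).coeff n * q ^ n =
      ∑' b : ((fun s : Finset ℕ => ∑ i ∈ s, (i + 1)) ⁻¹' {n}), ∏ i ∈ (b : Finset ℕ), -q ^ (i + 1) by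
    simp only [h4]
    exact h2
  intro n
  have hset : (fun s : Finset ℕ => ∑ i ∈ s, (i + 1)) ⁻¹' {n} =
      (((Finset.range n).powerset.filter fun s => ∑ i ∈ s, (i + 1) = n : Finset (Finset ℕ)) :
        Set (Finset ℕ)) := by
    ext s
    simp only [Set.mem_preimage, Set.mem_singleton_iff, Finset.coe_filter, Finset.mem_powerset,
      Set.mem_ofPred_eq]
    refine ⟨fun h => ⟨fun i hi => ?_, h⟩, fun h => h.2⟩
    have := Finset.single_le_sum (f := fun i => i + 1) (fun _ _ => Nat.zero_le _) hi
    rw [Finset.mem_range]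
    rw [← h]
    exact this
  rw [hset, Finset.tsum_subtype' _ (fun s => ∏ i ∈ s, (-q ^ (i + 1)))]
  have h3 := PowerSeries.X_pow_dvd_iff.mp (euler_dvd ℂ n) n (by omega)
  rw [map_sub, sub_eq_zero] at h3
  rw [h3, eulerFin]
  simp only [sub_eq_add_neg]
  rw [Finset.prod_one_add, map_sum, Finset.sum_mul, Finset.sum_filter]
  refine Finset.sum_congr rfl fun s _ => ?_
  rw [prod_neg_pow, prod_neg_pow, show ((-1 : ℂ⟦X⟧) ^ s.card) = C ((-1 : ℂ) ^ s.card) by simp,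
    coeff_C_mul, coeff_X_pow]
  split_ifs with h h' h'
  · rw [← h]; simp
  · exact absurd h.symm h'
  · exact absurd h'.symm h
  · simp

/-- absolute convergence of a power series at `q` with given value -/
def EvAt (q : ℂ) (F : ℂ⟦X⟧) (a : ℂ) : Prop :=
  (Summable fun n => ‖F.coeff n * q ^ n‖) ∧ HasSum (fun n => F.coeff n * q ^ n) a

lemma EvAt.mul {q : ℂ} {F G : ℂ⟦X⟧} {a b : ℂ} (hF : EvAt q F a) (hG : EvAt q G b) :
    EvAt q (F * G) (a * b) := by
  have e : ∀ n, (F * G).coeff n * q ^ n = ∑ kl ∈ Finset.HasAntidiagonal.antidiagonal n,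
      (F.coeff kl.1 * q ^ kl.1) * (G.coeff kl.2 * q ^ kl.2) := by
    intro n
    rw [coeff_mul, Finset.sum_mul]
    refine Finset.sum_congr rfl fun p hp => ?_
    rw [← Finset.HasAntidiagonal.mem_antidiagonal.mp hp]; ring
  have hs := summable_norm_sum_mul_antidiagonal_of_summable_norm hF.1 hG.1
  refine ⟨?_, ?_⟩
  · simpa only [e] using hs
  · simp only [e]
    rw [← hF.2.tsum_eq, ← hG.2.tsum_eq,
      tsum_mul_tsum_eq_tsum_sum_antidiagonal_of_summable_norm hF.1 hG.1]
    exact hs.of_norm.hasSum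

lemma EvAt.one (q : ℂ) : EvAt q 1 1 := by
  have h : HasSum (fun n => (1 : ℂ⟦X⟧).coeff n * q ^ n) 1 := by
    convert hasSum_single (0 : ℕ) ?_ using 1
    · simp
    · intro n hn; simp [coeff_one, hn]
  exact ⟨h.summable.norm, h⟩

lemma EvAt.X (q : ℂ) : EvAt q X q := by
  have h : HasSum (fun n => (PowerSeries.X : ℂ⟦X⟧).coeff n * q ^ n) q := by
    convert hasSum_single (1 : ℕ) ?_ using 1
    · simp
    · intro n hn; simp [coeff_X, hn]
  exact ⟨h.summable.norm, h⟩

lemma EvAt.pow {q : ℂ} {F : ℂ⟦X⟧} {a : ℂ} (hF : EvAt q F a) (k : ℕ) : EvAt q (F ^ k) (a ^ k) := by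
  induction k with
  | zero => simpa using EvAt.one q
  | succ k ih => rw [pow_succ, pow_succ]; exact ih.mul hF

lemma bern_values : bernoulli 4 = -1 / 30 ∧ bernoulli 6 = 1 / 42 ∧ bernoulli 10 = 5 / 66 ∧
    bernoulli 12 = -691 / 2730 := by
  have h4 := bernoulli'_four
  have h5 : bernoulli' 5 = 0 := by
    rw [bernoulli'_def]; norm_num [Finset.sum_range_succ, h4, Nat.choose]
  have h6 : bernoulli' 6 = 1 / 42 := by
    rw [bernoulli'_def]; norm_num [Finset.sum_range_succ, h4, h5, Nat.choose]
  have h7 : bernoulli' 7 = 0 := by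
    rw [bernoulli'_def]; norm_num [Finset.sum_range_succ, h4, h5, h6, Nat.choose]
  have h8 : bernoulli' 8 = -1 / 30 := by
    rw [bernoulli'_def]; norm_num [Finset.sum_range_succ, h4, h5, h6, h7, Nat.choose]
  have h9 : bernoulli' 9 = 0 := by
    rw [bernoulli'_def]; norm_num [Finset.sum_range_succ, h4, h5, h6, h7, h8, Nat.choose]
  have h10 : bernoulli' 10 = 5 / 66 := by
    rw [bernoulli'_def]; norm_num [Finset.sum_range_succ, h4, h5, h6, h7, h8, h9, Nat.choose]
  have h11 : bernoulli' 11 = 0 := by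
    rw [bernoulli'_def]; norm_num [Finset.sum_range_succ, h4, h5, h6, h7, h8, h9, h10, Nat.choose]
  have h12 : bernoulli' 12 = -691 / 2730 := by
    rw [bernoulli'_def]
    norm_num [Finset.sum_range_succ, h4, h5, h6, h7, h8, h9, h10, h11, Nat.choose]
  refine ⟨?_, ?_, ?_, ?_⟩ <;> rw [bernoulli_eq_bernoulli'_of_ne_one (by norm_num)] <;> assumption

section modular
open UpperHalfPlane ModularForm ModularFormClass MatrixGroups EisensteinSeries

/-- `E₄³ - E₆²` -/
noncomputable def dForm : ModularForm 𝒮ℒ 12 :=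
  ModularForm.mcast (by decide) (E₄.pow 3) - ModularForm.mcast (by decide) (E₆.pow 2)

lemma dForm_qExp : qExpansion 1 dForm = (qExpansion 1 E₄) ^ 3 - (qExpansion 1 E₆) ^ 2 := by
  simp only [dForm, FunLike.coe_sub, coe_mcast,
    ModularForm.qExpansion_sub one_pos one_mem_strictPeriods_SL,
    ModularForm.qExpansion_pow one_pos one_mem_strictPeriods_SL]

lemma delta_identity : (qExpansion 1 E₄) ^ 3 - (qExpansion 1 E₆) ^ 2 =
    C (1728 : ℂ) * (X * (pentagonalSeries ℂ) ^ 24) := by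
  rw [← dForm_qExp]
  ext m
  symm
  refine ModularFormClass.qExpansion_coeff_unique
    (c := fun m => (C (1728 : ℂ) * (X * (pentagonalSeries ℂ) ^ 24)).coeff m) (k := 12) (f := dForm) one_pos
    one_mem_strictPeriods_SL ?_ m
  intro τ
  have hq : ‖Function.Periodic.qParam 1 (τ : ℂ)‖ < 1 :=
    Function.Periodic.norm_qParam_lt_one one_pos τ.im_pos
  set q := Function.Periodic.qParam 1 (τ : ℂ) with hqdef
  have hp := pent_eval q hq
  have h1 : EvAt q (pentagonalSeries ℂ) (∏' i : ℕ, (1 - q ^ (i + 1))) := ⟨hp.summable.norm, hp⟩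
  have h2 := ((EvAt.X q).mul (h1.pow 24)).2.mul_left 1728
  have h3 : dForm τ = 1728 * (q * (∏' i : ℕ, (1 - q ^ (i + 1))) ^ 24) := by
    have e1 : dForm τ = E₄ τ ^ 3 - E₆ τ ^ 2 := by
      simp only [dForm, coe_mcast, ModularForm.coe_pow, sub_apply, Pi.pow_apply]
    have e2 := discriminant_eq_E₄_cube_sub_E₆_sq τ
    rw [discriminant_eq_q_prod, (multipliable_one_sub_pow hq).tprod_pow 24] at e2
    rw [e1]
    linear_combination (-1728) * e2
  rw [h3]
  simpa only [coeff_C_mul, smul_eq_mul, mul_assoc] using h2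

/-- Eisenstein-type series `a + c ∑ σ_k(m) X^m` -/
noncomputable def eisS (R : Type*) [CommRing R] (a c : ℤ) (k : ℕ) : R⟦X⟧ :=
  .mk fun m => if m = 0 then (a : R) else (c : R) * (ArithmeticFunction.sigma k m : R)

lemma eis4 : qExpansion 1 E₄ = eisS ℂ 1 240 3 := by
  ext m
  rw [E_qExpansion_coeff _ ⟨2, rfl⟩, eisS, coeff_mk]
  norm_num [bern_values.1]

lemma eis6 : qExpansion 1 E₆ = eisS ℂ 1 (-504) 5 := by
  ext m
  rw [E_qExpansion_coeff _ ⟨3, rfl⟩, eisS, coeff_mk]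
  norm_num [bern_values.2.1]

lemma eis10 : qExpansion 1 (E (k := 10) (by norm_num)) = eisS ℂ 1 (-264) 9 := by
  ext m
  rw [E_qExpansion_coeff _ ⟨5, rfl⟩, eisS, coeff_mk]
  norm_num [bern_values.2.2.1]

lemma eis12 : (691 : ℂ) • qExpansion 1 (E (k := 12) (by norm_num)) = eisS ℂ 691 65520 11 := by
  ext m
  rw [coeff_smul, E_qExpansion_coeff _ ⟨6, rfl⟩, eisS, coeff_mk]
  norm_num [bern_values.2.2.2]
  split_ifs
  · norm_num
  · ring

/-- `E₄ E₆ - E₁₀` -/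
noncomputable def tenForm : ModularForm 𝒮ℒ ((10 : ℕ) : ℤ) :=
  ModularForm.mcast (by decide) (E₄.mul E₆) - E (k := 10) (by norm_num)

lemma ten_identity : eisS ℂ 1 240 3 * eisS ℂ 1 (-504) 5 = eisS ℂ 1 (-264) 9 := by
  have hq : qExpansion 1 tenForm = eisS ℂ 1 240 3 * eisS ℂ 1 (-504) 5 - eisS ℂ 1 (-264) 9 := by
    rw [← eis4, ← eis6, ← eis10]
    simp only [tenForm, FunLike.coe_sub, coe_mcast,
      ModularForm.qExpansion_sub one_pos one_mem_strictPeriods_SL,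
      ModularForm.qExpansion_mul one_pos one_mem_strictPeriods_SL]
  have h0 : tenForm = 0 := by
    apply ModularForm.sturm_bound_levelOne_nat
    rw [hq]
    refine lt_of_lt_of_le ?_ (PowerSeries.nat_le_order _ 1 ?_)
    · norm_num
    · intro i hi
      obtain rfl : i = 0 := by omega
      simp [eisS, coeff_mul]
  rw [h0] at hq
  have hz : qExpansion 1 ((0 : ModularForm 𝒮ℒ ((10 : ℕ) : ℤ)) : ℍ → ℂ) = 0 := qExpansion_zero 1
  rw [hz] at hq
  exact (sub_eq_zero.mp hq.symm)

/-- `691 E₁₂ - 441 E₄³ - 250 E₆²` -/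
noncomputable def twelveForm : ModularForm 𝒮ℒ ((12 : ℕ) : ℤ) :=
  ((691 : ℂ) • E (k := 12) (by norm_num) - (441 : ℂ) • ModularForm.mcast (by decide) (E₄.pow 3))
    - (250 : ℂ) • ModularForm.mcast (by decide) (E₆.pow 2)

lemma twelve_identity : eisS ℂ 691 65520 11 =
   441 * (eisS ℂ 1 240 3) ^ 3 + 250 * (eisS ℂ 1 (-504) 5) ^ 2 := by
  have hq : qExpansion 1 twelveForm = eisS ℂ 691 65520 11 -
   441 * (eisS ℂ 1 240 3) ^ 3 - 250 * (eisS ℂ 1 (-504) 5) ^ 2 := by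
    rw [← eis4, ← eis6, ← eis12, twelveForm, FunLike.coe_sub,
      ModularForm.qExpansion_sub one_pos one_mem_strictPeriods_SL, FunLike.coe_sub,
      ModularForm.qExpansion_sub one_pos one_mem_strictPeriods_SL]
    rw [FunLike.coe_smul, FunLike.coe_smul, FunLike.coe_smul,
      ModularForm.qExpansion_smul one_pos one_mem_strictPeriods_SL,
      ModularForm.qExpansion_smul one_pos one_mem_strictPeriods_SL,
      ModularForm.qExpansion_smul one_pos one_mem_strictPeriods_SL, coe_mcast, coe_mcast,
      ModularForm.qExpansion_pow one_pos one_mem_strictPeriods_SL,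
      ModularForm.qExpansion_pow one_pos one_mem_strictPeriods_SL]
    simp only [PowerSeries.smul_eq_C_mul, map_ofNat]
  have h0 : twelveForm = 0 := by
    apply ModularForm.sturm_bound_levelOne_nat
    rw [hq]
    refine lt_of_lt_of_le ?_ (PowerSeries.nat_le_order _ 2 ?_)
    · norm_num
    · intro i hi
      rw [show (441 : ℂ⟦X⟧) = C 441 from rfl, show (250 : ℂ⟦X⟧) = C 250 from rfl]
      rw [map_sub, map_sub, coeff_C_mul, coeff_C_mul]
      interval_cases i
      · norm_num [eisS, coeff_mul, pow_succ]
      · norm_num [eisS, coeff_mul, pow_succ, Finset.Nat.antidiagonal_succ]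
  rw [h0] at hq
  have hz : qExpansion 1 ((0 : ModularForm 𝒮ℒ ((12 : ℕ) : ℤ)) : ℍ → ℂ) = 0 := qExpansion_zero 1
  rw [hz] at hq
  linear_combination -hq
end modular

lemma eisS_map {R S : Type*} [CommRing R] [CommRing S] (f : R →+* S) (a c : ℤ) (k : ℕ) :
    PowerSeries.map f (eisS R a c k) = eisS S a c k := by
  ext m
  simp only [eisS, coeff_map, coeff_mk]
  split_ifs <;> simp

lemma pent_map {R S : Type*} [CommRing R] [CommRing S] (f : R →+* S) :
    PowerSeries.map f (pentagonalSeries R) = pentagonalSeries S := by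
  ext m
  by_cases h : m ∈ Set.range pentagonal
  · obtain ⟨k, rfl⟩ := h
    rw [coeff_map, coeff_pentagonalSeries_pentagonal, coeff_pentagonalSeries_pentagonal]
    simp
  · rw [coeff_map, coeff_pentagonalSeries_eq_zero _ h, coeff_pentagonalSeries_eq_zero _ h, map_zero]

lemma map_inj : Function.Injective (PowerSeries.map (Int.castRingHom ℂ)) :=
  PowerSeries.map_injective _ Int.cast_injective

lemma ten_R (R : Type*) [CommRing R] :
    eisS R 1 240 3 * eisS R 1 (-504) 5 = eisS R 1 (-264) 9 := by
  have h : eisS ℤ 1 240 3 * eisS ℤ 1 (-504) 5 = eisS ℤ 1 (-264) 9 := by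
    apply map_inj
    simpa only [map_mul, eisS_map] using ten_identity
  simpa only [map_mul, eisS_map] using congrArg (PowerSeries.map (Int.castRingHom R)) h

lemma twelve_R (R : Type*) [CommRing R] : eisS R 691 65520 11 =
   441 * (eisS R 1 240 3) ^ 3 + 250 * (eisS R 1 (-504) 5) ^ 2 := by
  have h : eisS ℤ 691 65520 11 =
      441 * (eisS ℤ 1 240 3) ^ 3 + 250 * (eisS ℤ 1 (-504) 5) ^ 2 := by
    apply map_inj
    simpa only [map_mul, map_add, map_pow, map_ofNat, eisS_map] using twelve_identity
  simpa only [map_mul, map_add, map_pow, map_ofNat, eisS_map] using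
    congrArg (PowerSeries.map (Int.castRingHom R)) h

lemma delta_R (R : Type*) [CommRing R] : (eisS R 1 240 3) ^ 3 - (eisS R 1 (-504) 5) ^ 2 =
    1728 * (X * (pentagonalSeries R) ^ 24) := by
  have h : (eisS ℤ 1 240 3) ^ 3 - (eisS ℤ 1 (-504) 5) ^ 2 =
    1728 * (X * (pentagonalSeries ℤ) ^ 24) := by
    apply map_inj
    have := delta_identity
    rw [eis4, eis6, map_ofNat] at this
    simpa only [map_mul, map_sub, map_pow, map_ofNat, eisS_map, pent_map, map_X] using this
  simpa only [map_mul, map_sub, map_pow, map_ofNat, eisS_map, pent_map, map_X] using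
    congrArg (PowerSeries.map (Int.castRingHom R)) h


section theta
variable {R : Type*} [CommRing R]

/-- `X d/dX` -/
noncomputable def thetaD (f : R⟦X⟧) : R⟦X⟧ := X * derivative R f

lemma thetaD_mul (f g : R⟦X⟧) : thetaD (f * g) = f * thetaD g + g * thetaD f := by
  simp only [thetaD, Derivation.leibniz, smul_eq_mul]; ring

lemma thetaD_sub (f g : R⟦X⟧) : thetaD (f - g) = thetaD f - thetaD g := by
  simp only [thetaD, map_sub]; ring

lemma thetaD_add (f g : R⟦X⟧) : thetaD (f + g) = thetaD f + thetaD g := by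
  simp only [thetaD, map_add]; ring

lemma thetaD_one : thetaD (1 : R⟦X⟧) = 0 := by
  simp [thetaD]

lemma thetaD_pow (f : R⟦X⟧) (n : ℕ) : thetaD (f ^ (n + 1)) = (n + 1 : ℕ) * f ^ n * thetaD f := by
  simp only [thetaD, Derivation.leibniz_pow, smul_eq_mul, nsmul_eq_mul, Nat.add_sub_cancel]; ring

lemma coeff_thetaD (f : R⟦X⟧) (n : ℕ) : (thetaD f).coeff n = n * f.coeff n := by
  cases n with
  | zero => simp [thetaD]
  | succ n =>
    rw [thetaD, coeff_succ_X_mul]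
    rw [PowerSeries.coeff_derivative]
    push_cast
    ring

lemma thetaD_dvd (k : ℕ) (f g : R⟦X⟧) (h : X ^ k ∣ f - g) : X ^ k ∣ thetaD f - thetaD g := by
  rw [← thetaD_sub]
  rw [PowerSeries.X_pow_dvd_iff] at h ⊢
  intro m hm
  rw [coeff_thetaD, h m hm, mul_zero]

/-- `X^d / (1 - X^d)` -/
noncomputable def lamS (R : Type*) [CommRing R] (d : ℕ) : R⟦X⟧ :=
  .mk fun n => if n ≠ 0 ∧ d ∣ n then 1 else 0

lemma lamS_mul (d : ℕ) (hd : 0 < d) : lamS R d * (1 - X ^ d) = X ^ d := by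
  ext n
  rw [mul_sub, mul_one, map_sub, coeff_mul_X_pow', coeff_X_pow, lamS, coeff_mk]
  rcases lt_trichotomy n d with h | h | h
  · rw [if_neg (not_le.mpr h), if_neg h.ne, if_neg, sub_zero]
    rintro ⟨h1, h2⟩
    exact absurd (Nat.le_of_dvd (by omega) h2) (by omega)
  · subst h
    simp; omega
  · rw [if_pos h.le, coeff_mk, if_neg h.ne']
    have h1 : (d ∣ n - d) ↔ d ∣ n := by
      rw [← Nat.dvd_add_left (dvd_refl d), Nat.sub_add_cancel h.le]
    have h2 : n ≠ 0 := by omega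
    have h3 : n - d ≠ 0 := by omega
    simp [h1, h2, h3]

lemma coeff_natCast_mul' (c : ℕ) (f : R⟦X⟧) (m : ℕ) :
    ((c : R⟦X⟧) * f).coeff m = c * f.coeff m := by
  rw [show ((c : ℕ) : R⟦X⟧) = C (c : R) from (map_natCast (C : R →+* R⟦X⟧) c).symm, coeff_C_mul]

lemma thetaD_natCast_mul (c : ℕ) (f : R⟦X⟧) : thetaD ((c : R⟦X⟧) * f) = c * thetaD f := by
  ext m
  rw [coeff_thetaD, coeff_natCast_mul', coeff_natCast_mul', coeff_thetaD]
  ring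

lemma thetaD_X_pow (n : ℕ) : thetaD (X ^ n : R⟦X⟧) = (n : R⟦X⟧) * X ^ n := by
  ext m
  rw [coeff_thetaD, coeff_X_pow, coeff_natCast_mul', coeff_X_pow]
  split_ifs with h
  · rw [h]
  · simp

lemma thetaD_euler (N : ℕ) : thetaD (eulerFin R N) =
    - eulerFin R N * ∑ i ∈ Finset.range N, ((i + 1 : ℕ) : R⟦X⟧) * lamS R (i + 1) := by
  induction N with
  | zero => simp [eulerFin, thetaD_one]
  | succ N ih =>
    have e : eulerFin R (N + 1) = eulerFin R N * (1 - X ^ (N + 1)) := by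
      rw [eulerFin, Finset.prod_range_succ, eulerFin]
    rw [e, thetaD_mul, ih, thetaD_sub, thetaD_one, thetaD_X_pow, Finset.sum_range_succ]
    linear_combination (eulerFin R N) * ((N + 1 : ℕ) : R⟦X⟧) * lamS_mul (R := R) (N + 1) (by omega)

lemma lam_sum (N : ℕ) : (X : R⟦X⟧) ^ (N + 1) ∣
    (∑ i ∈ Finset.range N, ((i + 1 : ℕ) : R⟦X⟧) * lamS R (i + 1)) - eisS R 0 1 1 := by
  rw [PowerSeries.X_pow_dvd_iff]
  intro m hm
  rw [map_sub, sub_eq_zero, map_sum, eisS, coeff_mk]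
  simp only [coeff_natCast_mul', lamS, coeff_mk]
  split_ifs with h
  · simp [h]
  · rw [ArithmeticFunction.sigma_one_apply, Int.cast_one, one_mul, Nat.cast_sum]
    simp only [mul_ite, mul_one, mul_zero]
    rw [← Finset.sum_filter]
    refine Finset.sum_nbij' (fun i => i + 1) (fun d => d - 1) ?_ ?_ ?_ ?_ ?_
    · intro i hi
      rw [Finset.mem_filter] at hi
      exact Nat.mem_divisors.mpr ⟨hi.2.2, h⟩
    · intro d hd
      have h1 := Nat.pos_of_mem_divisors hd
      have h2 := Nat.divisor_le hd
      rw [Finset.mem_filter, Finset.mem_range, Nat.sub_add_cancel h1]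
      exact ⟨by omega, h, Nat.dvd_of_mem_divisors hd⟩
    · intro i _
      simp
    · intro d hd
      exact Nat.sub_add_cancel (Nat.pos_of_mem_divisors hd)
    · intro i _
      rfl

lemma thetaD_pent : thetaD (pentagonalSeries R) = - pentagonalSeries R * eisS R 0 1 1 := by
  apply eq_of_dvd_all
  intro N
  have h1 := (dvd_iff_mk _ _ _).mp (euler_dvd R N)
  have h2 := (dvd_iff_mk _ _ _).mp (thetaD_dvd _ _ _ (euler_dvd R N))
  have h3 := (dvd_iff_mk _ _ _).mp (lam_sum (R := R) N)
  rw [dvd_iff_mk, h2, thetaD_euler, map_mul, map_mul, map_neg, map_neg, h1, h3]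

lemma thetaD_delta : thetaD (X * pentagonalSeries R ^ 24) =
    eisS R 1 (-24) 1 * (X * pentagonalSeries R ^ 24) := by
  have h : eisS R 1 (-24) 1 = 1 - 24 * eisS R 0 1 1 := by
    ext m
    rw [show (24 : R⟦X⟧) = C 24 from (map_ofNat C 24).symm, map_sub, coeff_C_mul, coeff_one]
    simp only [eisS, coeff_mk]
    split_ifs <;> simp
  have hX : thetaD (X : R⟦X⟧) = X := by simpa using thetaD_X_pow (R := R) 1
  rw [thetaD_mul, thetaD_pow _ 23, thetaD_pent, hX, h]
  push_cast
  ring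

end theta

section ramanujan

lemma eleven_zero : (11 : (ZMod 11)⟦X⟧) = 0 := by
  rw [show (11 : (ZMod 11)⟦X⟧) = C 11 from (map_ofNat C 11).symm, show (11 : (ZMod 11)) = 0 from rfl, map_zero]

lemma QR_one : eisS (ZMod 11) 1 240 3 * eisS (ZMod 11) 1 (-504) 5 = 1 := by
  rw [ten_R]
  ext m
  rw [eisS, coeff_mk, coeff_one, show ((-264 : ℤ) : (ZMod 11)) = 0 from rfl]
  simp

lemma P_eq : eisS (ZMod 11) 1 (-24) 1 = 5 * eisS (ZMod 11) 1 240 3 ^ 3 + 7 * eisS (ZMod 11) 1 (-504) 5 ^ 2 := by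
  have h : eisS (ZMod 11) 1 (-24) 1 = 5 * eisS (ZMod 11) 691 65520 11 := by
    ext m
    rw [show (5 : (ZMod 11)⟦X⟧) = C 5 from (map_ofNat C 5).symm, coeff_C_mul, eisS, coeff_mk, eisS, coeff_mk]
    split_ifs with h
    · rfl
    · have : ((ArithmeticFunction.sigma 11 m : ℕ) : (ZMod 11)) = (ArithmeticFunction.sigma 1 m : ℕ) := by
        rw [ArithmeticFunction.sigma_apply, ArithmeticFunction.sigma_one_apply]
        push_cast
        refine Finset.sum_congr rfl fun d _ => ZMod.pow_card _
      rw [this, ← mul_assoc]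
      rfl
  rw [h, twelve_R]
  linear_combination (200 * eisS (ZMod 11) 1 240 3 ^ 3 + 113 * eisS (ZMod 11) 1 (-504) 5 ^ 2) * eleven_zero

lemma D_eq : (X * pentagonalSeries (ZMod 11) ^ 24) = eisS (ZMod 11) 1 240 3 ^ 3 - eisS (ZMod 11) 1 (-504) 5 ^ 2 := by
  rw [delta_R]
  linear_combination -157 * (X * pentagonalSeries (ZMod 11) ^ 24) * eleven_zero

lemma ram_alg (D P Q R : (ZMod 11)⟦X⟧) (hQR : Q * R = 1) (hP : P = 5 * Q ^ 3 + 7 * R ^ 2)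
    (hD : D = Q ^ 3 - R ^ 2) (hθ : thetaD D = P * D) (hP0 : P ≠ 0) :
    thetaD Q = 9 * Q * D ∧ thetaD R = - 9 * R * D := by
  have h11 := eleven_zero
  have h1 : Q * thetaD R + R * thetaD Q = 0 := by
    rw [← thetaD_mul, hQR, thetaD_one]
  have hR : thetaD R = - R ^ 2 * thetaD Q := by
    linear_combination R * h1 - thetaD R * hQR
  have h2 : 3 * Q ^ 2 * thetaD Q - 2 * R * thetaD R = P * D := by
    rw [← hθ, hD, thetaD_sub, thetaD_pow, thetaD_pow]
    push_cast; ring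
  have hQ : thetaD Q = 9 * Q * D := by
    apply mul_left_cancel₀ hP0
    linear_combination thetaD Q * hP + 9 * Q * h2 + 18 * Q * R * hR - 18 * R ^ 2 * thetaD Q * hQR
      - (2 * Q ^ 3 + R ^ 2) * thetaD Q * h11
  refine ⟨hQ, ?_⟩
  rw [hR, hQ]
  linear_combination (-9) * R * D * hQR

lemma ram_int (D Q R : (ZMod 11)⟦X⟧) (hQR : Q * R = 1) (hD : D = Q ^ 3 - R ^ 2)
    (hQ : thetaD Q = 9 * Q * D) (hR : thetaD R = - 9 * R * D) : ∃ F, D ^ 5 = thetaD F := by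
  have h11 := eleven_zero
  refine ⟨(5 : ℕ) * Q ^ 12 - (28 : ℕ) * Q ^ 7 + (48 : ℕ) * Q ^ 2 - (8 : ℕ) * R ^ 3
    + (9 : ℕ) * R ^ 8, ?_⟩
  simp only [thetaD_add, thetaD_sub, thetaD_natCast_mul]
  rw [thetaD_pow Q 11, thetaD_pow Q 6, thetaD_pow Q 1, thetaD_pow R 2, thetaD_pow R 7, hQ, hR]
  push_cast
  have h4 : D ^ 4 = Q ^ 12 - 4 * Q ^ 7 + 6 * Q ^ 2 - 4 * R ^ 3 + R ^ 8 := by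
    rw [hD]
    linear_combination (-4 * Q ^ 7 * (Q * R + 1) + 6 * Q ^ 2 * ((Q * R) ^ 3 + (Q * R) ^ 2 + Q * R + 1)
      - 4 * R ^ 3 * ((Q * R) ^ 2 + Q * R + 1)) * hQR
  linear_combination D * h4 +
    D * (-49 * Q ^ 12 + 160 * Q ^ 7 - 78 * Q ^ 2 - 20 * R ^ 3 + 59 * R ^ 8) * h11

/-- Ramanujan's congruence modulo 11 for `1/f_1` -/
lemma ramanujan_eleven (m : ℕ) : ((pentagonalSeries (ZMod 11))⁻¹).coeff (11 * m + 6) = 0 := by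
  have hc : constantCoeff (pentagonalSeries (ZMod 11)) = 1 := by
    rw [← coeff_zero_eq_constantCoeff_apply]
    simpa [pentagonal_def] using coeff_pentagonalSeries_pentagonal (ZMod 11) 0
  have hinv : pentagonalSeries (ZMod 11) * (pentagonalSeries (ZMod 11))⁻¹ = 1 :=
    PowerSeries.mul_inv_cancel _ (by rw [hc]; exact one_ne_zero)
  have hne : pentagonalSeries (ZMod 11) ≠ 0 := left_ne_zero_of_mul_eq_one hinv
  have hP0 : eisS (ZMod 11) 1 (-24) 1 ≠ 0 := by
    intro h
    have := congrArg (coeff 0) h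
    simp [eisS] at this
  obtain ⟨hQ, hR⟩ := ram_alg _ _ _ _ QR_one P_eq D_eq thetaD_delta hP0
  obtain ⟨F, hF⟩ := ram_int _ _ _ QR_one D_eq hQ hR
  have e : (X * pentagonalSeries (ZMod 11) ^ 24) ^ 5 = (X ^ 5 * (pentagonalSeries (ZMod 11))⁻¹) *
      expand 11 (by norm_num) (pentagonalSeries (ZMod 11) ^ 11) := by
    rw [expand_eleven]
    linear_combination (-1) * X ^ 5 * pentagonalSeries (ZMod 11) ^ 120 * hinv
  have h0 : dis 0 ((X * pentagonalSeries (ZMod 11) ^ 24) ^ 5) = 0 := by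
    ext n
    rw [hF, dis, coeff_mk, coeff_thetaD]
    push_cast
    rw [show (11 : (ZMod 11)) = 0 from rfl]
    simp
  rw [e, dis_mul 0 (by norm_num)] at h0
  have h1 := (mul_eq_zero.mp h0).resolve_right (pow_ne_zero _ hne)
  have h2 := congrArg (coeff (m + 1)) h1
  rw [dis, coeff_mk, coeff_X_pow_mul', if_pos (by omega)] at h2
  rw [show 11 * (m + 1) + 0 - 5 = 11 * m + 6 by omega] at h2
  simpa using h2

end ramanujan


lemma assembly (n : ℕ) : 11 ∣ genCubic 9 (121 * n + 36) := by
  have hc : constantCoeff (pentagonalSeries (ZMod 11)) = 1 := by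
    rw [← coeff_zero_eq_constantCoeff_apply]
    simpa [pentagonal_def] using coeff_pentagonalSeries_pentagonal (ZMod 11) 0
  have hinv : pentagonalSeries (ZMod 11) * (pentagonalSeries (ZMod 11))⁻¹ = 1 :=
    PowerSeries.mul_inv_cancel _ (by rw [hc]; exact one_ne_zero)
  have hne : pentagonalSeries (ZMod 11) ≠ 0 := left_ne_zero_of_mul_eq_one hinv
  have hram := ramanujan_eleven
  have hG := genCubic_gen (ZMod 11)
  have hpsi := psi_identity (ZMod 11)
  have hgS : gS = expand 2 (by norm_num) (pentagonalSeries (ZMod 11)) * psiS (ZMod 11) := rfl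
  have hv : expand 2 (by norm_num) (pentagonalSeries (ZMod 11)) *
      expand 2 (by norm_num) (pentagonalSeries (ZMod 11))⁻¹ = 1 := by
    rw [← map_mul, hinv, map_one]
  generalize hGG : (PowerSeries.mk fun k => (genCubic 9 k : ZMod 11)) = G at hG
  generalize hv' : expand 2 (by norm_num) (pentagonalSeries (ZMod 11))⁻¹ = v at hv
  generalize expand 2 (by norm_num) (pentagonalSeries (ZMod 11)) = f2 at hG hpsi hgS hv
  have h1 : G * f2 ^ 11 = gS := by
    apply mul_left_cancel₀ hne
    rw [hgS]
    linear_combination f2 ^ 3 * hG + f2 * hpsi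
  have h2 : G = gS * expand 11 (by norm_num) v := by
    rw [expand_eleven, ← h1, mul_assoc, ← mul_pow, hv, one_pow, mul_one]
  have h3 := dis_mul 3 (by norm_num) gS v
  rw [← h2] at h3
  have h4 := congrArg (coeff (11 * n + 3)) h3
  rw [dis, coeff_mk, ← hGG, coeff_mk, coeff_mul, Finset.sum_eq_zero,
    show 11 * (11 * n + 3) + 3 = 121 * n + 36 by ring] at h4
  · exact (ZMod.natCast_eq_zero_iff _ _).mp h4
  · rintro ⟨a, b⟩ hab
    rw [Finset.HasAntidiagonal.mem_antidiagonal] at hab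
    dsimp only at hab ⊢
    by_cases ha : a % 11 = 2
    · suffices v.coeff b = 0 by rw [this, mul_zero]
      rw [← hv']
      by_cases hb : 2 ∣ b
      · obtain ⟨m, rfl⟩ := hb
        rw [coeff_expand_mul]
        obtain ⟨k, rfl⟩ : ∃ k, m = 11 * k + 6 := ⟨m / 11, by omega⟩
        exact hram k
      · exact coeff_expand_of_not_dvd _ _ _ hb
    · rw [dis_g_zero a ha, zero_mul]

theorem stmt_15 : ∀ n : ℕ, 11 ∣ genCubic 9 (121 * n + 36) := by
  exact assembly
end
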